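/- Let N≥2 and 1*=N/(N−1)<q≤∞. If {u_k} is a bounded sequence in BV̇(R^N) such that for every sequence {(j_k,y_k)}⊂Z×R^N one has g[j_k,y_k]u_k ⇀ 0 weakly in BV̇(R^N), then ‖u_k‖_{L^{1*,q}(R^N)} → 0; i.e., the embedding BV̇(R^N) ↪ L^{1*,q}(R^N) is cocompact with respect to the group D also for 1*<q≤∞. -/

import Mathlib

open MeasureTheory Set Filter Topology ENNReal

noncomputable section

abbrev Euc (N : ℕ) := EuclideanSpace ℝ (Fin N)

/-- Decreasing rearrangement of `u` with respect to Lebesgue measure on `ℝ^N`. -/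
def rearr (N : ℕ) (u : Euc N → ℝ) (t : ℝ) : ℝ :=
  sInf {l : ℝ | 0 < l ∧ volume {x : Euc N | l < |u x|} ≤ ENNReal.ofReal t}

/-- Lorentz quasinorm `‖u‖_{L^{p,q}}` on `ℝ^N` (with `q = ∞` allowed). -/
def lorentz (N : ℕ) (p : ℝ) (q : ℝ≥0∞) (u : Euc N → ℝ) : ℝ≥0∞ :=
  if q = ∞ then ⨆ t ∈ Ioi (0:ℝ), ENNReal.ofReal (t ^ (1/p) * rearr N u t)
  else (∫⁻ t in Ioi (0:ℝ),
      ENNReal.ofReal ((t ^ (1/p) * rearr N u t) ^ q.toReal / t)) ^ (1 / q.toReal)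

/-- Divergence of a vector field on `ℝ^N`. -/
def divg (N : ℕ) (v : Euc N → Euc N) (x : Euc N) : ℝ :=
  ∑ i : Fin N, fderiv ℝ v x (EuclideanSpace.single i 1) i

/-- Total variation `‖Du‖_Ω` of `u` over a set `Ω`. -/
def TV (N : ℕ) (u : Euc N → ℝ) (Ω : Set (Euc N)) : ℝ≥0∞ :=
  ⨆ (v : Euc N → Euc N) (_ : ContDiff ℝ (⊤ : ℕ∞) v) (_ : HasCompactSupport v)
    (_ : ∀ x, ‖v x‖ ≤ 1) (_ : tsupport v ⊆ Ω),
    ENNReal.ofReal (∫ x, u x * divg N v x)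

/-- `u` vanishes at infinity. -/
def VanishAtInfinity (N : ℕ) (u : Euc N → ℝ) : Prop :=
  ∀ M : ℝ, 0 < M → volume {x : Euc N | M < |u x|} < ∞

/-- Membership in `BV̇(ℝ^N)`. -/
def MemBVdot (N : ℕ) (u : Euc N → ℝ) : Prop :=
  Measurable u ∧ VanishAtInfinity N u ∧ TV N u univ < ∞

/-- The rescaling `g[j,y]u = 2^{(N-1)j} u (2^j (· - y))`. -/
def resc (N : ℕ) (j : ℤ) (y : Euc N) (u : Euc N → ℝ) : Euc N → ℝ :=
  fun x => (2:ℝ) ^ (((N:ℤ) - 1) * j) * u ((2:ℝ) ^ j • (x - y))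

/-- Weak convergence `u k ⇀ w` in `BV̇(ℝ^N)`. -/
def WeakBVconv (N : ℕ) (u : ℕ → Euc N → ℝ) (w : Euc N → ℝ) : Prop :=
  (∀ K : Set (Euc N), IsCompact K →
      Tendsto (fun k => ∫ x in K, |u k x - w x|) atTop (𝓝 0)) ∧
  ∀ i : Fin N, ∀ f : Euc N → ℝ, ContDiff ℝ (⊤ : ℕ∞) f → HasCompactSupport f →
      Tendsto (fun k => ∫ x, u k x * fderiv ℝ f x (EuclideanSpace.single i 1)) atTop
        (𝓝 (∫ x, w x * fderiv ℝ f x (EuclideanSpace.single i 1)))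

/-- A continuous cutoff with values in `[0, 1]`, vanishing for `|s| ≤ 1 / n` and for `|s| ≥ n`. -/
def ramp (n : ℕ) (s : ℝ) : ℝ := max 0 (min 1 (n * |s| - 1)) * max 0 (min 1 (n - |s|))

/-- A bounded `C¹` truncation of the identity that vanishes near the origin. -/
def trunc (n : ℕ) (s : ℝ) : ℝ := ∫ r in (0 : ℝ)..s, ramp n r

lemma continuous_ramp (n : ℕ) : Continuous (ramp n) := by
  unfold ramp; fun_prop

lemma ramp_nonneg (n : ℕ) (s : ℝ) : 0 ≤ ramp n s := by
  unfold ramp; positivity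

lemma ramp_le_one (n : ℕ) (s : ℝ) : ramp n s ≤ 1 :=
  mul_le_one₀ (max_le zero_le_one (min_le_left _ _)) (le_max_left _ _)
    (max_le zero_le_one (min_le_left _ _))

lemma ramp_neg (n : ℕ) (s : ℝ) : ramp n (-s) = ramp n s := by
  simp [ramp]

lemma ramp_eq_zero_of_small {n : ℕ} {s : ℝ} (h : n * |s| ≤ 1) : ramp n s = 0 := by
  have : min 1 (n * |s| - 1) ≤ 0 := (min_le_right _ _).trans (by linarith)
  simp [ramp, max_eq_left this]

lemma ramp_eq_zero_of_large {n : ℕ} {s : ℝ} (h : n ≤ |s|) : ramp n s = 0 := by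
  have : min 1 (n - |s|) ≤ 0 := (min_le_right _ _).trans (by linarith)
  simp [ramp, max_eq_left this]

lemma ramp_eq_one {n : ℕ} {s : ℝ} (h : 2 ≤ n * |s|) (h' : |s| + 1 ≤ n) : ramp n s = 1 := by
  rw [ramp, min_eq_left (by linarith), min_eq_left (by linarith)]
  simp

lemma hasDerivAt_trunc (n : ℕ) (s : ℝ) : HasDerivAt (trunc n) (ramp n s) s :=
  intervalIntegral.integral_hasDerivAt_right ((continuous_ramp n).intervalIntegrable _ _)
    ((continuous_ramp n).stronglyMeasurableAtFilter _ _) (continuous_ramp n).continuousAt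

lemma contDiff_trunc (n : ℕ) : ContDiff ℝ 1 (trunc n) := by
  rw [contDiff_one_iff_deriv]
  refine ⟨fun s => (hasDerivAt_trunc n s).differentiableAt, ?_⟩
  rw [show deriv (trunc n) = ramp n from funext fun s => (hasDerivAt_trunc n s).deriv]
  exact continuous_ramp n

lemma trunc_neg (n : ℕ) (s : ℝ) : trunc n (-s) = -trunc n s := by
  have := intervalIntegral.integral_comp_neg (a := 0) (b := s) (ramp n)
  simp only [ramp_neg, neg_zero] at this
  rw [trunc, trunc, this, intervalIntegral.integral_symm]

lemma abs_trunc (n : ℕ) (s : ℝ) : |trunc n s| = trunc n |s| := by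
  have h : ∀ r : ℝ, 0 ≤ r → |trunc n r| = trunc n r := fun r hr =>
    abs_of_nonneg (intervalIntegral.integral_nonneg hr fun _ _ => ramp_nonneg _ _)
  rcases abs_cases s with ⟨h1, h2⟩ | ⟨h1, h2⟩
  · rw [h1, h s h2]
  · rw [h1, ← h (-s) (by linarith), trunc_neg, abs_neg]

lemma abs_trunc_le_abs (n : ℕ) (s : ℝ) : |trunc n s| ≤ |s| := by
  have := intervalIntegral.norm_integral_le_of_norm_le_const (f := ramp n) (a := 0) (b := s)
    (C := 1) (fun x _ => by
      rw [Real.norm_of_nonneg (ramp_nonneg _ _)]; exact ramp_le_one _ _)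
  simpa [trunc] using this

lemma trunc_eq_zero {n : ℕ} {s : ℝ} (h : n * |s| ≤ 1) : trunc n s = 0 := by
  rw [← abs_eq_zero, abs_trunc, trunc, intervalIntegral.integral_zero_ae]
  refine Eventually.of_forall fun r hr => ramp_eq_zero_of_small (le_trans ?_ h)
  rw [uIoc_of_le (abs_nonneg _)] at hr
  rw [abs_of_pos hr.1]
  exact mul_le_mul_of_nonneg_left hr.2 (Nat.cast_nonneg _)

lemma abs_trunc_le (n : ℕ) (s : ℝ) : |trunc n s| ≤ n := by
  rcases le_total |s| n with h | h
  · exact (abs_trunc_le_abs n s).trans h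
  · rw [abs_trunc, trunc, ← intervalIntegral.integral_add_adjacent_intervals (b := (n : ℝ))
      ((continuous_ramp n).intervalIntegrable _ _) ((continuous_ramp n).intervalIntegrable _ _)]
    have h2 : ∫ r in (n : ℝ)..|s|, ramp n r = 0 := by
      refine intervalIntegral.integral_zero_ae (Eventually.of_forall fun r hr => ?_)
      rw [uIoc_of_le h] at hr
      exact ramp_eq_zero_of_large (hr.1.le.trans (le_abs_self r))
    rw [h2, add_zero]
    have := abs_trunc_le_abs n n
    rw [Nat.abs_cast] at this
    exact (le_abs_self _).trans this

lemma tendsto_trunc (s : ℝ) : Tendsto (fun n => trunc n s) atTop (𝓝 s) := by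
  have h : Tendsto (fun n => ∫ r in (0 : ℝ)..s, ramp n r) atTop
      (𝓝 (∫ _ in (0 : ℝ)..s, (1 : ℝ))) := by
    refine intervalIntegral.tendsto_integral_filter_of_dominated_convergence (fun _ => 1)
      (Eventually.of_forall fun n => (continuous_ramp n).aestronglyMeasurable)
      (Eventually.of_forall fun n => Eventually.of_forall fun r _ => by
        rw [Real.norm_of_nonneg (ramp_nonneg _ _)]; exact ramp_le_one _ _)
      intervalIntegrable_const ?_
    have h0 : ∀ᵐ r : ℝ, r ≠ 0 := by simp [ae_iff, measure_singleton]
    filter_upwards [h0] with r hr _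
    refine tendsto_const_nhds.congr' ?_
    filter_upwards [eventually_ge_atTop ⌈2 / |r|⌉₊, eventually_ge_atTop ⌈|r| + 1⌉₊] with n h1 h2
    refine (ramp_eq_one ?_ (Nat.ceil_le.1 h2)).symm
    exact (div_le_iff₀ (abs_pos.2 hr)).1 (Nat.ceil_le.1 h1)
  simpa [trunc] using h

lemma third_le_abs_trunc {s : ℝ} (h : 1 < |s|) : 1 / 3 ≤ |trunc 3 s| := by
  have hi : ∀ a b : ℝ, IntervalIntegrable (ramp 3) volume a b :=
    fun a b => (continuous_ramp 3).intervalIntegrable _ _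
  have hn : ∀ a b : ℝ, a ≤ b → 0 ≤ ∫ r in a..b, ramp 3 r := fun a b hab =>
    intervalIntegral.integral_nonneg hab fun _ _ => ramp_nonneg _ _
  have h1 : ∫ r in (2 / 3 : ℝ)..1, ramp 3 r = 1 / 3 := by
    rw [intervalIntegral.integral_congr (g := fun _ => (1 : ℝ))]
    · norm_num
    · intro r hr
      rw [uIcc_of_le (by norm_num)] at hr
      have : |r| = r := abs_of_nonneg (by linarith [hr.1])
      exact ramp_eq_one (by rw [this]; push_cast; linarith [hr.1])
        (by rw [this]; push_cast; linarith [hr.2])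
  rw [abs_trunc, trunc,
    ← intervalIntegral.integral_add_adjacent_intervals (hi 0 1) (hi 1 |s|),
    ← intervalIntegral.integral_add_adjacent_intervals (hi 0 (2 / 3)) (hi (2 / 3) 1), h1]
  linarith [hn 0 (2 / 3) (by norm_num), hn 1 |s| h.le]

lemma fderiv_single_apply {N : ℕ} {v : Euc N → Euc N} {x : Euc N} (hv : DifferentiableAt ℝ v x)
    (i : Fin N) (w : Euc N) : fderiv ℝ v x w i = fderiv ℝ (fun y => v y i) x w := by
  have := ((EuclideanSpace.proj i : Euc N →L[ℝ] ℝ).hasFDerivAt.comp x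
    hv.hasFDerivAt).fderiv
  have h2 : (⇑(EuclideanSpace.proj i : Euc N →L[ℝ] ℝ) ∘ v)
    = fun y => v y i := rfl
  rw [h2] at this
  rw [this]; rfl

lemma continuous_divg {N : ℕ} {v : Euc N → Euc N} (hv : ContDiff ℝ (⊤ : ℕ∞) v) :
    Continuous (divg N v) := by
  have h := hv.continuous_fderiv (by simp)
  unfold divg
  refine continuous_finsetSum _ fun i _ => ?_
  exact (EuclideanSpace.proj i : Euc N →L[ℝ] ℝ).continuous.comp
    (h.clm_apply continuous_const)

lemma hasCompactSupport_divg {N : ℕ} {v : Euc N → Euc N} (hv : HasCompactSupport v) :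
    HasCompactSupport (divg N v) := by
  refine (hv.fderiv ℝ).mono fun x hx => ?_
  contrapose! hx
  simp only [Function.mem_support, not_not] at hx ⊢
  simp [divg, hx]

lemma integral_mul_divg_le {N : ℕ} {u : Euc N → ℝ} {C : ℝ} (hC : 0 ≤ C)
    (hu : TV N u univ ≤ ENNReal.ofReal C) {v : Euc N → Euc N} (hv : ContDiff ℝ (⊤ : ℕ∞) v)
    (hv' : HasCompactSupport v) (hv1 : ∀ x, ‖v x‖ ≤ 1) :
    ∫ x, u x * divg N v x ≤ C := by
  rw [← ENNReal.ofReal_le_ofReal_iff hC]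
  refine le_trans ?_ hu
  exact le_iSup₂_of_le v hv (le_iSup₂_of_le hv' hv1 (le_iSup_of_le (subset_univ _) le_rfl))

lemma integral_mul_divg_eq {N : ℕ} {U : Euc N → ℝ} (hU : ContDiff ℝ (⊤ : ℕ∞) U)
    {v : Euc N → Euc N} (hv : ContDiff ℝ (⊤ : ℕ∞) v) (hv' : HasCompactSupport v) :
    ∫ x, U x * divg N v x = - ∫ x, fderiv ℝ U x (v x) := by
  have hvi : ∀ i, ContDiff ℝ (⊤ : ℕ∞) (fun x => v x i) := fun i =>
    (contDiff_euclidean.1 hv) i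
  have hvc : ∀ i, HasCompactSupport (fun x => v x i) := fun i => by
    refine hv'.mono fun x hx => ?_
    contrapose! hx
    simp only [Function.mem_support, not_not] at hx ⊢
    simp [hx]
  have hUd : ∀ w, Continuous (fun x => fderiv ℝ U x w) := fun w =>
    (hU.continuous_fderiv (by simp)).clm_apply continuous_const
  have hvd : ∀ i w, Continuous (fun x => fderiv ℝ (fun y => v y i) x w) := fun i w =>
    ((hvi i).continuous_fderiv (by simp)).clm_apply continuous_const
  have hvdc : ∀ i w, HasCompactSupport (fun x => fderiv ℝ (fun y => v y i) x w) := fun i w =>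
    (hvc i).fderiv_apply ℝ w
  have h1 : ∀ x, U x * divg N v x = ∑ i, U x * fderiv ℝ (fun y => v y i) x
      (EuclideanSpace.single i 1) := fun x => by
    rw [divg, Finset.mul_sum]
    exact Finset.sum_congr rfl fun i _ => by
      rw [fderiv_single_apply (hv.differentiable (by simp) x)]
  have h2 : ∀ x, fderiv ℝ U x (v x) = ∑ i, fderiv ℝ U x (EuclideanSpace.single i 1) * v x i :=
    fun x => by
    have : v x = ∑ i, v x i • EuclideanSpace.single i (1 : ℝ) := by
      ext j; simp [Finset.sum_apply, Pi.single_apply]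
    conv_lhs => rw [this]
    simp [map_sum, mul_comm]
  simp_rw [h1, h2]
  rw [integral_finsetSum, integral_finsetSum, ← Finset.sum_neg_distrib]
  · refine Finset.sum_congr rfl fun i _ => ?_
    refine integral_mul_fderiv_eq_neg_fderiv_mul_of_integrable ?_ ?_ ?_
      (fun x _ => hU.differentiable (by simp) x) (fun x _ => (hvi i).differentiable (by simp) x)
    · exact ((hUd _).mul (hvi i).continuous).integrable_of_hasCompactSupport (hvc i).mul_left
    · exact (hU.continuous.mul (hvd i _)).integrable_of_hasCompactSupport (hvdc i _).mul_left
    · exact (hU.continuous.mul (hvi i).continuous).integrable_of_hasCompactSupport (hvc i).mul_left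
  · exact fun i _ =>
      ((hUd _).mul (hvi i).continuous).integrable_of_hasCompactSupport (hvc i).mul_left
  · exact fun i _ =>
      (hU.continuous.mul (hvd i _)).integrable_of_hasCompactSupport (hvdc i _).mul_left

/-- The gradient of `U` in coordinates. -/
def grad {N : ℕ} (U : Euc N → ℝ) (x : Euc N) : Euc N :=
  WithLp.toLp 2 fun i => fderiv ℝ U x (EuclideanSpace.single i 1)

lemma fderiv_apply_eq_inner_grad {N : ℕ} (U : Euc N → ℝ) (x w : Euc N) :
    fderiv ℝ U x w = inner ℝ (grad U x) w := by
  have : w = ∑ i, w i • EuclideanSpace.single i (1 : ℝ) := by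
    ext j; simp [Finset.sum_apply, Pi.single_apply]
  conv_lhs => rw [this]
  simp [map_sum, PiLp.inner_apply, grad]

lemma contDiff_grad {N : ℕ} {U : Euc N → ℝ} (hU : ContDiff ℝ (⊤ : ℕ∞) U) :
    ContDiff ℝ (⊤ : ℕ∞) (grad U) := by
  rw [contDiff_euclidean]
  intro i
  exact (hU.fderiv_right (m := (⊤ : ℕ∞)) (by simp)).clm_apply contDiff_const

lemma norm_fderiv_le_norm_grad {N : ℕ} (U : Euc N → ℝ) (x : Euc N) :
    ‖fderiv ℝ U x‖ ≤ ‖grad U x‖ :=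
  ContinuousLinearMap.opNorm_le_bound _ (norm_nonneg _) fun w => by
    rw [fderiv_apply_eq_inner_grad]; exact norm_inner_le_norm _ _

lemma integral_bump_mul_norm_grad_le {N : ℕ} {U : Euc N → ℝ} (hU : ContDiff ℝ (⊤ : ℕ∞) U) {C : ℝ}
    (hUC : ∀ v : Euc N → Euc N, ContDiff ℝ (⊤ : ℕ∞) v → HasCompactSupport v →
      (∀ x, ‖v x‖ ≤ 1) → ∫ x, U x * divg N v x ≤ C) (χ : ContDiffBump (0 : Euc N)) :
    ∫ x, χ x * ‖grad U x‖ ≤ C := by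
  have hG := contDiff_grad hU
  have hint : Integrable (fun x => χ x * ‖grad U x‖) :=
    (χ.continuous.mul hG.continuous.norm).integrable_of_hasCompactSupport
      χ.hasCompactSupport.mul_right
  have hintχ : Integrable χ := χ.continuous.integrable_of_hasCompactSupport χ.hasCompactSupport
  have key : ∀ δ : ℝ, 0 < δ → ∫ x, χ x * ‖grad U x‖ ≤ C + δ * ∫ x, χ x := by
    intro δ hδ
    set s : Euc N → ℝ := fun x => √(δ ^ 2 + ‖grad U x‖ ^ 2) with hs
    have hspos : ∀ x, 0 < s x := fun x => Real.sqrt_pos.2 (by positivity)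
    have hsG : ∀ x, ‖grad U x‖ ≤ s x := fun x => Real.le_sqrt_of_sq_le (by nlinarith)
    have hsG' : ∀ x, s x ≤ ‖grad U x‖ + δ := fun x =>
      Real.sqrt_le_iff.2 ⟨by positivity, by nlinarith [norm_nonneg (grad U x)]⟩
    have hsmooth : ContDiff ℝ (⊤ : ℕ∞) s :=
      (contDiff_const.add (hG.norm_sq ℝ)).sqrt fun x => by positivity
    set v : Euc N → Euc N := fun x => (-(χ x / s x)) • grad U x with hvdef
    have hv : ContDiff ℝ (⊤ : ℕ∞) v :=
      ((χ.contDiff.div hsmooth fun x => (hspos x).ne').neg).smul hG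
    have hv' : HasCompactSupport v := χ.hasCompactSupport.mono fun x hx => by
      contrapose! hx
      simp only [Function.mem_support, not_not] at hx ⊢
      simp [hvdef, hx]
    have hv1 : ∀ x, ‖v x‖ ≤ 1 := fun x => by
      rw [hvdef]
      simp only [norm_smul, norm_neg, norm_div, Real.norm_of_nonneg χ.nonneg,
        Real.norm_of_nonneg (hspos x).le]
      rw [div_mul_eq_mul_div, div_le_one (hspos x)]
      calc χ x * ‖grad U x‖ ≤ 1 * s x :=
            mul_le_mul χ.le_one (hsG x) (norm_nonneg _) zero_le_one
        _ = s x := one_mul _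
    have h := hUC v hv hv' hv1
    rw [integral_mul_divg_eq hU hv hv', ← integral_neg] at h
    have hle : ∫ x, (χ x * ‖grad U x‖ - δ * χ x) ≤ ∫ x, -(fderiv ℝ U x) (v x) := by
      refine integral_mono (hint.sub (hintχ.const_mul δ)) ?_ fun x => ?_
      · refine Integrable.neg (Continuous.integrable_of_hasCompactSupport
          ((hU.continuous_fderiv (by simp)).clm_apply hv.continuous) ?_)
        refine hv'.mono fun x hx => ?_
        contrapose! hx
        simp only [Function.mem_support, not_not] at hx ⊢
        simp [hx]
      · have h3 : -(fderiv ℝ U x) (v x) = χ x / s x * ‖grad U x‖ ^ 2 := by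
          rw [fderiv_apply_eq_inner_grad, hvdef]
          simp [inner_smul_right]
        simp only [h3]
        rw [div_mul_eq_mul_div, le_div_iff₀ (hspos x)]
        have h4 : (‖grad U x‖ - δ) * s x ≤ ‖grad U x‖ ^ 2 := by
          have h5 := Real.sq_sqrt (show 0 ≤ δ ^ 2 + ‖grad U x‖ ^ 2 by positivity)
          rw [← show s x = √(δ ^ 2 + ‖grad U x‖ ^ 2) from rfl] at h5
          nlinarith [hsG x, hsG' x, hspos x, norm_nonneg (grad U x)]
        nlinarith [χ.nonneg (x := x)]
    rw [integral_sub hint (hintχ.const_mul δ), integral_const_mul] at hle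
    linarith
  have hlim : Tendsto (fun δ : ℝ => C + δ * ∫ x, χ x) (𝓝[>] 0) (𝓝 (C + 0 * ∫ x, χ x)) :=
    ((continuous_const.add (continuous_id.mul continuous_const)).tendsto 0).mono_left
      nhdsWithin_le_nhds
  rw [zero_mul, add_zero] at hlim
  exact ge_of_tendsto hlim (eventually_mem_nhdsWithin.mono key)

lemma lintegral_enorm_fderiv_le {N : ℕ} {U : Euc N → ℝ} (hU : ContDiff ℝ (⊤ : ℕ∞) U) {C : ℝ}
    (hUC : ∀ v : Euc N → Euc N, ContDiff ℝ (⊤ : ℕ∞) v → HasCompactSupport v →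
      (∀ x, ‖v x‖ ≤ 1) → ∫ x, U x * divg N v x ≤ C) :
    ∫⁻ x, ‖fderiv ℝ U x‖ₑ ≤ ENNReal.ofReal C := by
  have hG := contDiff_grad hU
  have hcov : AECover (volume : Measure (Euc N)) atTop fun R : ℝ => Metric.ball (0 : Euc N) R :=
    aecover_ball tendsto_id
  have hmeas : AEMeasurable (fun x => ‖fderiv ℝ U x‖ₑ) :=
    (hU.continuous_fderiv (by simp)).enorm.aemeasurable
  refine le_of_tendsto (hcov.lintegral_tendsto_of_countably_generated hmeas) ?_
  filter_upwards [eventually_gt_atTop 0] with R hR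
  let χ : ContDiffBump (0 : Euc N) := ⟨R, R + 1, hR, by linarith⟩
  have hint : Integrable (fun x => χ x * ‖grad U x‖) :=
    (χ.continuous.mul hG.continuous.norm).integrable_of_hasCompactSupport
      χ.hasCompactSupport.mul_right
  calc ∫⁻ x in Metric.ball 0 R, ‖fderiv ℝ U x‖ₑ
      ≤ ∫⁻ x in Metric.ball 0 R, ENNReal.ofReal (χ x * ‖grad U x‖) := by
        refine setLIntegral_mono' measurableSet_ball fun x hx => ?_
        rw [χ.one_of_mem_closedBall (Metric.ball_subset_closedBall hx), one_mul,
          ← ofReal_norm]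
        exact ENNReal.ofReal_le_ofReal (norm_fderiv_le_norm_grad U x)
    _ ≤ ∫⁻ x, ENNReal.ofReal (χ x * ‖grad U x‖) := setLIntegral_le_lintegral _ _
    _ = ENNReal.ofReal (∫ x, χ x * ‖grad U x‖) :=
        (ofReal_integral_eq_lintegral_ofReal hint
          (Eventually.of_forall fun x => mul_nonneg χ.nonneg (norm_nonneg _))).symm
    _ ≤ ENNReal.ofReal C :=
        ENNReal.ofReal_le_ofReal (integral_bump_mul_norm_grad_le hU hUC χ)

lemma divg_comp_add_right {N : ℕ} (v : Euc N → Euc N) (t x : Euc N) :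
    divg N (fun y => v (y + t)) x = divg N v (x + t) := by
  simp only [divg, fderiv_comp_add_right]

lemma integral_convolution_mul_divg_le {N : ℕ} {u : Euc N → ℝ} (hul : LocallyIntegrable u) {C : ℝ}
    (hC : 0 ≤ C) (hu : TV N u univ ≤ ENNReal.ofReal C) (φ : ContDiffBump (0 : Euc N))
    {v : Euc N → Euc N} (hv : ContDiff ℝ (⊤ : ℕ∞) v) (hv' : HasCompactSupport v)
    (hv1 : ∀ x, ‖v x‖ ≤ 1) :
    ∫ x, (convolution (φ.normed volume) u (ContinuousLinearMap.lsmul ℝ ℝ) volume) x * divg N v x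
      ≤ C := by
  set ρ := φ.normed volume with hρ
  have hd := continuous_divg hv
  have hdc := hasCompactSupport_divg hv'
  obtain ⟨R, hR⟩ := hdc.isCompact.isBounded.subset_closedBall 0
  obtain ⟨S, hS⟩ :=
    φ.hasCompactSupport_normed (μ := volume) |>.isCompact.isBounded.subset_closedBall 0
  obtain ⟨D, hD⟩ := hd.bounded_above_of_compact_support hdc
  have hg : Integrable ((Metric.closedBall (0 : Euc N) (R + S)).indicator u) :=
    (hul.integrableOn_isCompact (isCompact_closedBall _ _)).integrable_indicator
      measurableSet_closedBall
  have hint : Integrable (fun p : Euc N × Euc N => ρ p.2 * u (p.1 - p.2) * divg N v p.1)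
      (volume.prod volume) := by
    have h1 := Integrable.convolution_integrand (ContinuousLinearMap.lsmul ℝ ℝ)
      (φ.integrable_normed (μ := volume)) hg
    have h2 := h1.mul_bdd (c := D) (g := fun p : Euc N × Euc N => divg N v p.1)
      (hd.comp continuous_fst).aestronglyMeasurable (Eventually.of_forall fun p => hD _)
    refine h2.congr (Eventually.of_forall fun p => ?_)
    by_cases hp1 : p.1 ∈ tsupport (divg N v)
    · by_cases hp2 : p.2 ∈ tsupport ρ
      · have : p.1 - p.2 ∈ Metric.closedBall (0 : Euc N) (R + S) := by
          have e1 := hR hp1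
          have e2 := hS hp2
          rw [mem_closedBall_zero_iff] at e1 e2 ⊢
          exact (norm_sub_le _ _).trans (add_le_add e1 e2)
        simp [indicator_of_mem this, hρ]
      · have : ρ p.2 = 0 := image_eq_zero_of_notMem_tsupport hp2
        have h3 : φ.normed volume p.2 = 0 := this
        simp [this, h3]
    · simp [image_eq_zero_of_notMem_tsupport hp1]
  have hswap : ∫ x, (convolution ρ u (ContinuousLinearMap.lsmul ℝ ℝ) volume) x * divg N v x
      = ∫ t, ρ t * ∫ x, u (x - t) * divg N v x := by
    have e1 : ∀ x, (convolution ρ u (ContinuousLinearMap.lsmul ℝ ℝ) volume) x * divg N v x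
        = ∫ t, ρ t * u (x - t) * divg N v x := fun x => by
      rw [integral_mul_const]; rfl
    simp_rw [e1]
    rw [integral_integral_swap hint]
    refine integral_congr_ae (Eventually.of_forall fun t => ?_)
    simp only [mul_assoc]
    rw [integral_const_mul]
  have hle : ∀ t, ∫ x, u (x - t) * divg N v x ≤ C := fun t => by
    have e : ∫ x, u (x - t) * divg N v x = ∫ x, u x * divg N (fun y => v (y + t)) x := by
      rw [← integral_add_right_eq_self (fun x => u (x - t) * divg N v x) t]
      simp [divg_comp_add_right]
    rw [e]
    exact integral_mul_divg_le hC hu (hv.comp (contDiff_id.add contDiff_const))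
      (hv'.comp_homeomorph (Homeomorph.addRight t)) fun x => hv1 _
  rw [hswap]
  calc ∫ t, ρ t * ∫ x, u (x - t) * divg N v x ≤ ∫ t, ρ t * C := by
        refine integral_mono ?_ (φ.integrable_normed.mul_const C) fun t =>
          mul_le_mul_of_nonneg_left (hle t) (φ.nonneg_normed t)
        have := hint.integral_prod_right
        simp only [mul_assoc, integral_const_mul] at this
        exact this
    _ = C := by rw [integral_mul_const, φ.integral_normed, one_mul]

/-- A locally integrable function of bounded variation is the a.e. limit of smooth functions with
no larger variation. -/
lemma exists_smooth_approx {N : ℕ} {u : Euc N → ℝ} (hul : LocallyIntegrable u) {C : ℝ}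
    (hC : 0 ≤ C) (hu : TV N u univ ≤ ENNReal.ofReal C) :
    ∃ U : ℕ → Euc N → ℝ, (∀ n, ContDiff ℝ (⊤ : ℕ∞) (U n)) ∧
      (∀ᵐ x, Tendsto (fun n => U n x) atTop (𝓝 (u x))) ∧
      ∀ n, ∫⁻ x, ‖fderiv ℝ (U n) x‖ₑ ≤ ENNReal.ofReal C := by
  let φ : ℕ → ContDiffBump (0 : Euc N) := fun n =>
    ⟨1 / ((n : ℝ) + 1), 2 * (1 / ((n : ℝ) + 1)), by positivity,
      by have : 0 < 1 / ((n : ℝ) + 1) := by positivity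
         linarith⟩
  have hφ : Tendsto (fun n => (φ n).rOut) atTop (𝓝 0) := by
    have := (tendsto_one_div_add_atTop_nhds_zero_nat (𝕜 := ℝ)).const_mul 2
    rwa [mul_zero] at this
  have hsm : ∀ n, ContDiff ℝ (⊤ : ℕ∞)
      (convolution ((φ n).normed volume) u (ContinuousLinearMap.lsmul ℝ ℝ) volume) := fun n =>
    (φ n).hasCompactSupport_normed.contDiff_convolution_left _ (φ n).contDiff_normed hul
  refine ⟨_, hsm, ContDiffBump.ae_convolution_tendsto_right_of_locallyIntegrable (K := 2) hφ
    (Eventually.of_forall fun n => le_rfl) hul, fun n => ?_⟩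
  exact lintegral_enorm_fderiv_le (hsm n) fun v hv hv' hv1 =>
    integral_convolution_mul_divg_le hul hC hu (φ n) hv hv' hv1

lemma enorm_clm_add_le {E : Type*} [NormedAddCommGroup E] [NormedSpace ℝ E] (A B : E →L[ℝ] ℝ) :
    ‖A + B‖ₑ ≤ ‖A‖ₑ + ‖B‖ₑ := by
  simp only [← ofReal_norm]
  rw [← ENNReal.ofReal_add (norm_nonneg _) (norm_nonneg _)]
  exact ENNReal.ofReal_le_ofReal (norm_add_le _ _)

lemma enorm_clm_smul {E : Type*} [NormedAddCommGroup E] [NormedSpace ℝ E] (c : ℝ) (A : E →L[ℝ] ℝ) :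
    ‖c • A‖ₑ = ‖c‖ₑ * ‖A‖ₑ := by
  simp only [← ofReal_norm]
  rw [← ENNReal.ofReal_mul (norm_nonneg _), norm_smul]

lemma integrable_trunc_comp {N : ℕ} {u : Euc N → ℝ} (hm : Measurable u)
    (hv : VanishAtInfinity N u) (n : ℕ) : Integrable fun x => trunc n (u x) := by
  have hT : Measurable fun x => trunc n (u x) := (contDiff_trunc n).continuous.measurable.comp hm
  rcases Nat.eq_zero_or_pos n with rfl | hn
  · have : (fun x => trunc 0 (u x)) = fun _ => 0 := funext fun x => trunc_eq_zero (by simp)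
    rw [this]; exact integrable_zero _ _ _
  have hn' : (0 : ℝ) < n := Nat.cast_pos.2 hn
  have hs : MeasurableSet {x | 1 / (n : ℝ) < |u x|} := measurableSet_lt measurable_const hm.abs
  refine (IntegrableOn.of_bound (hv (1 / n) (by positivity)) hT.aestronglyMeasurable (n : ℝ)
    (Eventually.of_forall fun x => abs_trunc_le n _)).integrable_of_forall_notMem_eq_zero
    fun x hx => trunc_eq_zero ?_
  simp only [mem_ofPred_eq, not_lt] at hx
  rwa [le_div_iff₀ hn', mul_comm] at hx

lemma fderiv_trunc_comp {N : ℕ} {U : Euc N → ℝ} (hU : Differentiable ℝ U) (n : ℕ) (x : Euc N) :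
    ‖fderiv ℝ (fun y => trunc n (U y)) x‖ ≤ ‖fderiv ℝ U x‖ := by
  have := ((hasDerivAt_trunc n (U x)).comp_hasFDerivAt x (hU x).hasFDerivAt).fderiv
  rw [show (fun y => trunc n (U y)) = trunc n ∘ U from rfl, this, norm_smul,
    Real.norm_of_nonneg (ramp_nonneg _ _)]
  exact mul_le_of_le_one_left (norm_nonneg _) (ramp_le_one _ _)

/-- A truncated function of bounded variation is approximated in `L¹` by compactly supported `C¹`
functions with almost no increase of the variation. -/
lemma exists_compactlySupported_approx {N : ℕ} {u : Euc N → ℝ} (hm : Measurable u)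
    (hv : VanishAtInfinity N u) (hul : LocallyIntegrable u) {C : ℝ} (hC : 0 ≤ C)
    (hu : TV N u univ ≤ ENNReal.ofReal C) (n : ℕ) {ε : ℝ} (hε : 0 < ε) :
    ∃ f : Euc N → ℝ, ContDiff ℝ 1 f ∧ HasCompactSupport f ∧
      ∫⁻ x, ‖f x - trunc n (u x)‖ₑ ≤ ENNReal.ofReal ε ∧
      ∫⁻ x, ‖fderiv ℝ f x‖ₑ ≤ ENNReal.ofReal C + ENNReal.ofReal ε := by
  obtain ⟨U, hUs, hUlim, hUC⟩ := exists_smooth_approx hul hC hu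
  have hw := integrable_trunc_comp hm hv n
  set w : Euc N → ℝ := fun x => trunc n (u x) with hwdef
  set W : ℕ → Euc N → ℝ := fun m x => trunc n (U m x) with hWdef
  have hW1 : ∀ m, ContDiff ℝ 1 (W m) := fun m =>
    (contDiff_trunc n).comp ((hUs m).of_le (by exact_mod_cast le_top))
  have hwm : Measurable w := (contDiff_trunc n).continuous.measurable.comp hm
  have hWlim : ∀ᵐ x, Tendsto (fun m => W m x) atTop (𝓝 (w x)) := by
    filter_upwards [hUlim] with x hx
    exact ((contDiff_trunc n).continuous.tendsto _).comp hx
  have hJ : ∫⁻ x, ‖w x‖ₑ < ∞ := hw.2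
  let χ : ContDiffBump (0 : Euc N) := ⟨1, 2, one_pos, one_lt_two⟩
  have hχ1 : ContDiff ℝ 1 χ := χ.contDiff
  obtain ⟨L, hL⟩ := (hχ1.continuous_fderiv (by simp)).bounded_above_of_compact_support
    (χ.hasCompactSupport.fderiv ℝ)
  have hL0 : 0 ≤ L := (norm_nonneg _).trans (hL 0)
  set r : ℕ → ℝ := fun k => 1 / ((k : ℝ) + 1) with hr
  have hrpos : ∀ k, 0 < r k := fun k => by positivity
  have hrlim : Tendsto r atTop (𝓝 0) := tendsto_one_div_add_atTop_nhds_zero_nat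
  have h1 : Tendsto (fun k => ∫⁻ x, ‖(1 - χ (r k • x)) * w x‖ₑ) atTop (𝓝 0) := by
    have := tendsto_lintegral_of_dominated_convergence (μ := (volume : Measure (Euc N)))
      (F := fun k x => ‖(1 - χ (r k • x)) * w x‖ₑ) (f := fun _ => 0) (fun x => ‖w x‖ₑ)
      (fun k => by
        have : Measurable fun x : Euc N => χ (r k • x) :=
          (χ.continuous.comp (continuous_const_smul (r k))).measurable
        exact ((measurable_const.sub this).mul hwm).enorm)
      (fun k => Eventually.of_forall fun x => by
        simp only [enorm_mul]
        refine mul_le_of_le_one_left zero_le ?_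
        rw [← ofReal_norm, ENNReal.ofReal_le_one,
          Real.norm_of_nonneg (by linarith [χ.le_one (x := r k • x)])]
        linarith [χ.nonneg (x := r k • x)])
      hJ.ne
      (Eventually.of_forall fun x => by
        have h2 : Tendsto (fun k => r k • x) atTop (𝓝 ((0 : ℝ) • x)) := hrlim.smul_const x
        rw [zero_smul] at h2
        have h3 := (χ.continuous.tendsto 0).comp h2
        have h4 : χ (0 : Euc N) = 1 := χ.one_of_mem_closedBall (by simp [χ])
        rw [h4] at h3
        have h5 := ((tendsto_const_nhds (x := (1 : ℝ))).sub h3).mul_const (w x)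
        have h6 := (continuous_enorm.tendsto _).comp h5
        simpa [Function.comp_def] using h6)
    simpa using this
  have h2 : Tendsto (fun k => ENNReal.ofReal (L * r k) * (1 + ∫⁻ x, ‖w x‖ₑ)) atTop (𝓝 0) := by
    have h3 : Tendsto (fun k => ENNReal.ofReal (L * r k)) atTop (𝓝 0) := by
      have := ENNReal.tendsto_ofReal (hrlim.const_mul L)
      simpa using this
    have := ENNReal.Tendsto.mul_const h3 (b := 1 + ∫⁻ x, ‖w x‖ₑ)
      (Or.inr (ENNReal.add_ne_top.2 ⟨by simp, hJ.ne⟩))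
    simpa using this
  have hε2 : (0 : ℝ≥0∞) < ENNReal.ofReal (ε / 2) := ENNReal.ofReal_pos.2 (by positivity)
  obtain ⟨k, hk1, hk2⟩ := ((h1.eventually_le_const hε2).and
    (h2.eventually_le_const (ENNReal.ofReal_pos.2 hε))).exists
  set K : Set (Euc N) := Metric.closedBall 0 (2 / r k) with hK
  have hKfin : volume K < ∞ := measure_closedBall_lt_top
  have h3 : Tendsto (fun m => ∫⁻ x in K, ‖W m x - w x‖ₑ) atTop (𝓝 0) := by
    have := tendsto_lintegral_of_dominated_convergence (μ := volume.restrict K)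
      (F := fun m x => ‖W m x - w x‖ₑ) (f := fun _ => 0) (fun x => ENNReal.ofReal (2 * n))
      (fun m => ((hW1 m).continuous.measurable.sub hwm).enorm)
      (fun m => Eventually.of_forall fun x => by
        simp only
        rw [← ofReal_norm]
        refine ENNReal.ofReal_le_ofReal ((norm_sub_le _ _).trans ?_)
        have e1 := abs_trunc_le n (U m x)
        have e2 := abs_trunc_le n (u x)
        simp only [hWdef, hwdef, Real.norm_eq_abs]
        linarith)
      (by simp [ENNReal.mul_eq_top, hKfin.ne])
      (ae_restrict_of_ae (by
        filter_upwards [hWlim] with x hx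
        have h5 := hx.sub_const (w x)
        have h6 := (continuous_enorm.tendsto _).comp h5
        simpa [Function.comp_def] using h6))
    simpa using this
  obtain ⟨m, hm1, hm2⟩ := ((h3.eventually_le_const hε2).and
    (h3.eventually_le_const one_pos)).exists
  set ψ : Euc N → ℝ := fun x => χ (r k • x) with hψ
  have hψ1 : ContDiff ℝ 1 ψ := hχ1.comp (contDiff_const_smul _)
  have hψc : HasCompactSupport ψ := χ.hasCompactSupport.comp_smul (hrpos k).ne'
  have hψK : ∀ x, x ∉ K → ψ x = 0 := fun x hx => by
    refine χ.zero_of_le_dist ?_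
    simp only [hK, Metric.mem_closedBall, dist_zero_right, not_le] at hx
    rw [dist_zero_right, norm_smul, Real.norm_of_nonneg (hrpos k).le]
    rw [div_lt_iff₀ (hrpos k)] at hx
    change (2 : ℝ) ≤ _
    linarith
  have hψ01 : ∀ x, ‖ψ x‖ₑ ≤ 1 := fun x => by
    rw [← ofReal_norm, ENNReal.ofReal_le_one, Real.norm_of_nonneg χ.nonneg]
    exact χ.le_one
  have hdψ : ∀ x, ‖fderiv ℝ ψ x‖ₑ ≤ K.indicator (fun _ => ENNReal.ofReal (L * r k)) x := fun x => by
    have e : fderiv ℝ ψ x = r k • fderiv ℝ χ (r k • x) := by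
      rw [hψ]; exact fderiv_comp_smul (f := χ) (r k)
    by_cases hx : x ∈ K
    · rw [indicator_of_mem hx, ← ofReal_norm, e, norm_smul, Real.norm_of_nonneg (hrpos k).le,
        mul_comm]
      exact ENNReal.ofReal_le_ofReal (mul_le_mul_of_nonneg_right (hL _) (hrpos k).le)
    · rw [indicator_of_notMem hx]
      have : ψ =ᶠ[𝓝 x] fun _ => 0 := by
        filter_upwards [Metric.isClosed_closedBall.isOpen_compl.mem_nhds hx] with y hy
        exact hψK y hy
      rw [this.fderiv_eq, ← ofReal_norm]; simp
  have hKm : MeasurableSet K := measurableSet_closedBall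
  have hWw : Measurable (K.indicator fun x => ‖W m x - w x‖ₑ) :=
    Measurable.indicator ((hW1 m).continuous.measurable.sub hwm).enorm hKm
  refine ⟨fun x => ψ x * W m x, hψ1.mul (hW1 m), hψc.mul_right, ?_, ?_⟩
  · calc ∫⁻ x, ‖ψ x * W m x - w x‖ₑ
        ≤ ∫⁻ x, (K.indicator (fun x => ‖W m x - w x‖ₑ) x + ‖(1 - ψ x) * w x‖ₑ) := by
          refine lintegral_mono fun x => ?_
          have e : ψ x * W m x - w x = ψ x * (W m x - w x) - (1 - ψ x) * w x := by ring
          rw [e]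
          refine (enorm_sub_le).trans (add_le_add ?_ le_rfl)
          by_cases hx : x ∈ K
          · rw [indicator_of_mem hx, enorm_mul]
            exact mul_le_of_le_one_left zero_le (hψ01 x)
          · simp [hψK x hx]
      _ = (∫⁻ x in K, ‖W m x - w x‖ₑ) + ∫⁻ x, ‖(1 - ψ x) * w x‖ₑ := by
          rw [lintegral_add_left hWw,
            lintegral_indicator hKm]
      _ ≤ ENNReal.ofReal (ε / 2) + ENNReal.ofReal (ε / 2) := add_le_add hm1 hk1
      _ = ENNReal.ofReal ε := by
          rw [← ENNReal.ofReal_add (by positivity) (by positivity), add_halves]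
  · calc ∫⁻ x, ‖fderiv ℝ (fun x => ψ x * W m x) x‖ₑ
        ≤ ∫⁻ x, (‖fderiv ℝ (U m) x‖ₑ + ENNReal.ofReal (L * r k) *
            (K.indicator (fun x => ‖W m x - w x‖ₑ) x + ‖w x‖ₑ)) := by
          refine lintegral_mono fun x => ?_
          rw [fderiv_fun_mul (hψ1.differentiable (by simp) x) ((hW1 m).differentiable (by simp) x)]
          refine (enorm_clm_add_le _ _).trans (add_le_add ?_ ?_)
          · rw [enorm_clm_smul]
            refine (mul_le_of_le_one_left zero_le (hψ01 x)).trans ?_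
            rw [← ofReal_norm, ← ofReal_norm]
            exact ENNReal.ofReal_le_ofReal
              (fderiv_trunc_comp ((hUs m).differentiable (by simp)) n x)
          · rw [enorm_clm_smul, mul_comm]
            by_cases hx : x ∈ K
            · have := hdψ x
              rw [indicator_of_mem hx] at this ⊢
              refine mul_le_mul' this ?_
              calc ‖W m x‖ₑ = ‖(W m x - w x) + w x‖ₑ := by rw [sub_add_cancel]
                _ ≤ _ := enorm_add_le _ _
            · have := hdψ x
              rw [indicator_of_notMem hx] at this
              simp [le_zero_iff.1 this]
      _ = (∫⁻ x, ‖fderiv ℝ (U m) x‖ₑ) + ENNReal.ofReal (L * r k) *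
            ((∫⁻ x in K, ‖W m x - w x‖ₑ) + ∫⁻ x, ‖w x‖ₑ) := by
          rw [lintegral_add_left ((hUs m).continuous_fderiv (by simp)).measurable.enorm,
            lintegral_const_mul' _ _ ENNReal.ofReal_ne_top,
            lintegral_add_left hWw,
            lintegral_indicator hKm]
      _ ≤ ENNReal.ofReal C + ENNReal.ofReal ε := by
          refine add_le_add (hUC m) (le_trans ?_ hk2)
          gcongr

lemma holderConjugate_dim {N : ℕ} (hN : 2 ≤ N) :
    Real.HolderConjugate (N : ℝ) ((N : ℝ) / ((N : ℝ) - 1)) := by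
  have : (2 : ℝ) ≤ N := by exact_mod_cast hN
  exact Real.HolderConjugate.conjExponent (by linarith)

/-- The Gagliardo–Nirenberg–Sobolev inequality for compactly supported `C¹` functions. -/
lemma exists_sobolev_const {N : ℕ} (hN : 2 ≤ N) :
    ∃ S : ℝ≥0∞, S ≠ ∞ ∧ ∀ f : Euc N → ℝ, ContDiff ℝ 1 f → HasCompactSupport f →
      ∫⁻ x, ‖f x‖ₑ ^ ((N : ℝ) / ((N : ℝ) - 1)) ≤
        S * (∫⁻ x, ‖fderiv ℝ f x‖ₑ) ^ ((N : ℝ) / ((N : ℝ) - 1)) := by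
  refine ⟨_, ENNReal.coe_ne_top, fun f hf hf' =>
    lintegral_pow_le_pow_lintegral_fderiv volume hf hf' ?_⟩
  rw [finrank_euclideanSpace_fin]
  exact holderConjugate_dim hN

lemma lintegral_rpow_le_of_tendsto_ae {N : ℕ} {f : ℕ → Euc N → ℝ} {w : Euc N → ℝ}
    (hf : ∀ k, Measurable (f k)) (hlim : ∀ᵐ x, Tendsto (fun k => f k x) atTop (𝓝 (w x))) (r : ℝ)
    {b : ℕ → ℝ≥0∞} {B : ℝ≥0∞} (hb : ∀ k, ∫⁻ x, ‖f k x‖ₑ ^ r ≤ b k)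
    (hB : Tendsto b atTop (𝓝 B)) : ∫⁻ x, ‖w x‖ₑ ^ r ≤ B := by
  calc ∫⁻ x, ‖w x‖ₑ ^ r = ∫⁻ x, liminf (fun k => ‖f k x‖ₑ ^ r) atTop := by
        refine lintegral_congr_ae ?_
        filter_upwards [hlim] with x hx
        have h1 : Tendsto (fun k => ‖f k x‖ₑ) atTop (𝓝 ‖w x‖ₑ) :=
          (continuous_enorm.tendsto _).comp hx
        exact (((ENNReal.continuous_rpow_const (y := r)).tendsto _).comp h1).liminf_eq.symm
    _ ≤ liminf (fun k => ∫⁻ x, ‖f k x‖ₑ ^ r) atTop :=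
        lintegral_liminf_le fun k => (hf k).enorm.pow_const r
    _ ≤ liminf b atTop := liminf_le_liminf (Eventually.of_forall hb)
    _ = B := hB.liminf_eq

/-- A sequence version of `exists_compactlySupported_approx` with almost everywhere convergence. -/
lemma exists_compactlySupported_seq {N : ℕ} {u : Euc N → ℝ} (hm : Measurable u)
    (hv : VanishAtInfinity N u) (hul : LocallyIntegrable u) {C : ℝ} (hC : 0 ≤ C)
    (hu : TV N u univ ≤ ENNReal.ofReal C) (n : ℕ) :
    ∃ (f : ℕ → Euc N → ℝ) (e : ℕ → ℝ≥0∞), (∀ k, ContDiff ℝ 1 (f k)) ∧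
      (∀ k, HasCompactSupport (f k)) ∧ Tendsto e atTop (𝓝 0) ∧
      (∀ k, ∫⁻ x, ‖f k x - trunc n (u x)‖ₑ ≤ e k) ∧
      (∀ k, ∫⁻ x, ‖fderiv ℝ (f k) x‖ₑ ≤ ENNReal.ofReal C + e k) ∧
      ∀ᵐ x, Tendsto (fun k => f k x) atTop (𝓝 (trunc n (u x))) := by
  have h := fun k : ℕ => exists_compactlySupported_approx hm hv hul hC hu n
    (ε := 1 / ((k : ℝ) + 1)) (by positivity)
  choose f hf1 hf2 hf3 hf4 using h
  have he : Tendsto (fun k : ℕ => ENNReal.ofReal (1 / ((k : ℝ) + 1))) atTop (𝓝 0) := by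
    have := ENNReal.tendsto_ofReal (tendsto_one_div_add_atTop_nhds_zero_nat (𝕜 := ℝ))
    simpa using this
  have hwm : Measurable fun x => trunc n (u x) := (contDiff_trunc n).continuous.measurable.comp hm
  have hmeas : TendstoInMeasure volume f atTop fun x => trunc n (u x) := by
    refine tendstoInMeasure_of_tendsto_eLpNorm one_ne_zero
      (fun k => (hf1 k).continuous.aestronglyMeasurable) hwm.aestronglyMeasurable ?_
    refine tendsto_of_tendsto_of_tendsto_of_le_of_le tendsto_const_nhds he
      (fun _ => zero_le) fun k => ?_
    rw [eLpNorm_one_eq_lintegral_enorm]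
    exact hf3 k
  obtain ⟨ns, hns, hae⟩ := hmeas.exists_seq_tendsto_ae
  exact ⟨fun k => f (ns k), fun k => ENNReal.ofReal (1 / ((ns k : ℝ) + 1)), fun k => hf1 _,
    fun k => hf2 _, he.comp hns.tendsto_atTop, fun k => hf3 _, fun k => hf4 _, hae⟩

/-- The Sobolev inequality in `BV̇`. -/
lemma lintegral_rpow_le_of_TV_le {N : ℕ} (hN : 2 ≤ N) {S : ℝ≥0∞} (hS : S ≠ ∞)
    (hSob : ∀ f : Euc N → ℝ, ContDiff ℝ 1 f → HasCompactSupport f →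
      ∫⁻ x, ‖f x‖ₑ ^ ((N : ℝ) / ((N : ℝ) - 1)) ≤
        S * (∫⁻ x, ‖fderiv ℝ f x‖ₑ) ^ ((N : ℝ) / ((N : ℝ) - 1)))
    {u : Euc N → ℝ} (hm : Measurable u)
    (hv : VanishAtInfinity N u) (hul : LocallyIntegrable u) {C : ℝ} (hC : 0 ≤ C)
    (hu : TV N u univ ≤ ENNReal.ofReal C) :
    ∫⁻ x, ‖u x‖ₑ ^ ((N : ℝ) / ((N : ℝ) - 1)) ≤
      S * (ENNReal.ofReal C) ^ ((N : ℝ) / ((N : ℝ) - 1)) := by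
  have hp := (holderConjugate_dim hN).symm.pos
  set p := (N : ℝ) / ((N : ℝ) - 1)
  refine lintegral_rpow_le_of_tendsto_ae (f := fun n x => trunc n (u x))
    (fun n => (contDiff_trunc n).continuous.measurable.comp hm)
    (Eventually.of_forall fun x => tendsto_trunc (u x)) p (fun n => ?_) tendsto_const_nhds
  obtain ⟨f, e, hf1, hf2, he, -, hf4, hae⟩ := exists_compactlySupported_seq hm hv hul hC hu n
  refine lintegral_rpow_le_of_tendsto_ae (fun k => (hf1 k).continuous.measurable) hae p
    (b := fun k => S * (ENNReal.ofReal C + e k) ^ p) (fun k => ?_) ?_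
  · refine (hSob _ (hf1 k) (hf2 k)).trans ?_
    gcongr
    exact hf4 k
  · have h1 : Tendsto (fun k => ENNReal.ofReal C + e k) atTop (𝓝 (ENNReal.ofReal C + 0)) :=
      tendsto_const_nhds.add he
    rw [add_zero] at h1
    exact ENNReal.Tendsto.const_mul
      (((ENNReal.continuous_rpow_const (y := p)).tendsto _).comp h1) (Or.inr hS)

lemma lintegral_setLIntegral_closedBall {N : ℕ} {F : Euc N → ℝ≥0∞} (hF : Measurable F) (r : ℝ) :
    ∫⁻ z, ∫⁻ x in Metric.closedBall z r, F x =
      volume (Metric.closedBall (0 : Euc N) r) * ∫⁻ x, F x := by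
  set B := Metric.closedBall (0 : Euc N) r with hB
  have hBm : MeasurableSet B := measurableSet_closedBall
  have h1 : ∀ z, ∫⁻ x in Metric.closedBall z r, F x
      = ∫⁻ x, B.indicator (fun _ => 1) (x - z) * F x := fun z => by
    rw [← lintegral_indicator measurableSet_closedBall]
    refine lintegral_congr fun x => ?_
    by_cases hx : x ∈ Metric.closedBall z r
    · have : x - z ∈ B := by simpa [hB, dist_eq_norm] using hx
      simp [hx, this]
    · have : x - z ∉ B := by simpa [hB, dist_eq_norm] using hx
      simp [hx, this]
  have hmeas : Measurable (B.indicator (fun _ => (1 : ℝ≥0∞))) := measurable_const.indicator hBm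
  simp_rw [h1]
  rw [lintegral_lintegral_swap]
  · have h2 : ∀ x, ∫⁻ z, B.indicator (fun _ => (1 : ℝ≥0∞)) (x - z) * F x = volume B * F x :=
      fun x => by
      have hmx : Measurable fun z => B.indicator (fun _ => (1 : ℝ≥0∞)) (x - z) :=
        hmeas.comp (measurable_const.sub measurable_id)
      rw [lintegral_mul_const _ hmx,
        lintegral_sub_left_eq_self (fun z => B.indicator (fun _ => (1 : ℝ≥0∞)) z) x,
        lintegral_indicator hBm]
      simp
    simp_rw [h2]
    rw [lintegral_const_mul _ hF]
  · exact ((hmeas.comp (measurable_snd.sub measurable_fst)).mul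
      (hF.comp measurable_snd)).aemeasurable

/-- A Lions-type inequality for compactly supported `C¹` functions. -/
lemma exists_lions_const {N : ℕ} (hN : 2 ≤ N) :
    ∃ A : ℝ≥0∞, A ≠ ∞ ∧ ∀ (f : Euc N → ℝ) (η : ℝ≥0∞), η ≠ ∞ → ContDiff ℝ 1 f → HasCompactSupport f →
      (∀ z, ∫⁻ x in Metric.closedBall z 1, ‖f x‖ₑ ≤ η) →
      ∫⁻ x, ‖f x‖ₑ ^ (1 + 1 / (N : ℝ)) ≤
        A * (η ^ (1 / (N : ℝ)) * ((∫⁻ x, ‖fderiv ℝ f x‖ₑ) + ∫⁻ x, ‖f x‖ₑ)) := by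
  obtain ⟨S, hS, hSob⟩ := exists_sobolev_const hN
  have hconj := holderConjugate_dim hN
  have hp := hconj.symm.pos
  have hNpos : (0 : ℝ) < N := hconj.pos
  set p := (N : ℝ) / ((N : ℝ) - 1)
  let χ : ContDiffBump (0 : Euc N) := ⟨1 / 2, 1, by norm_num, by norm_num⟩
  have hχ1 : ContDiff ℝ 1 χ := χ.contDiff
  obtain ⟨L, hL⟩ := (hχ1.continuous_fderiv (by simp)).bounded_above_of_compact_support
    (χ.hasCompactSupport.fderiv ℝ)
  set a := volume (Metric.closedBall (0 : Euc N) (1 / 2)) with ha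
  set b := volume (Metric.closedBall (0 : Euc N) 1) with hb
  have ha0 : a ≠ 0 := (Metric.measure_closedBall_pos volume _ (by norm_num)).ne'
  have hat : a ≠ ∞ := measure_closedBall_lt_top.ne
  have hbt : b ≠ ∞ := measure_closedBall_lt_top.ne
  set M : ℝ≥0∞ := 1 + ENNReal.ofReal L with hM
  have hMt : M ≠ ∞ := by simp [hM]
  refine ⟨a⁻¹ * (S ^ (1 / p) * (b * M)), ?_, fun f η hηt hf hf' hη => ?_⟩
  · exact ENNReal.mul_ne_top (ENNReal.inv_ne_top.2 ha0) (ENNReal.mul_ne_top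
      (ENNReal.rpow_ne_top_of_nonneg (by positivity) hS) (ENNReal.mul_ne_top hbt hMt))
  have hloc : ∀ z, ∫⁻ x in Metric.closedBall z (1 / 2), ‖f x‖ₑ ^ (1 + 1 / (N : ℝ)) ≤
      (η ^ (1 / (N : ℝ)) * S ^ (1 / p) * M) *
        ∫⁻ x in Metric.closedBall z 1, (‖fderiv ℝ f x‖ₑ + ‖f x‖ₑ) := by
    intro z
    set ψ : Euc N → ℝ := fun x => χ (x - z) with hψ
    have hψ1 : ContDiff ℝ 1 ψ := hχ1.comp (contDiff_id.sub contDiff_const)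
    have hψK : ∀ x, x ∉ Metric.closedBall z 1 → ψ x = 0 := fun x hx => by
      refine χ.zero_of_le_dist ?_
      simp only [Metric.mem_closedBall, not_le, dist_eq_norm] at hx
      rw [dist_zero_right]
      exact hx.le
    have hψ01 : ∀ x, ‖ψ x‖ₑ ≤ 1 := fun x => by
      rw [← ofReal_norm, ENNReal.ofReal_le_one, Real.norm_of_nonneg χ.nonneg]
      exact χ.le_one
    have hdψ : ∀ x, ‖fderiv ℝ ψ x‖ₑ ≤ ENNReal.ofReal L := fun x => by
      have e : fderiv ℝ ψ x = fderiv ℝ χ (x - z) := by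
        rw [hψ]; exact fderiv_comp_sub (f := χ) z
      rw [← ofReal_norm, e]
      exact ENNReal.ofReal_le_ofReal (hL _)
    have hdψK : ∀ x, x ∉ Metric.closedBall z 1 → fderiv ℝ ψ x = 0 := fun x hx => by
      have : ψ =ᶠ[𝓝 x] fun _ => 0 := by
        filter_upwards [Metric.isClosed_closedBall.isOpen_compl.mem_nhds hx] with y hy
        exact hψK y hy
      rw [this.fderiv_eq]; simp
    set h : Euc N → ℝ := fun x => ψ x * f x with hh
    have hh1 : ContDiff ℝ 1 h := hψ1.mul hf
    have hhc : HasCompactSupport h := hf'.mul_left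
    have e1 : ∫⁻ x, ‖h x‖ₑ ≤ η := by
      refine le_trans ?_ (hη z)
      rw [← lintegral_indicator measurableSet_closedBall]
      refine lintegral_mono fun x => ?_
      by_cases hx : x ∈ Metric.closedBall z 1
      · rw [indicator_of_mem hx, hh, enorm_mul]
        exact mul_le_of_le_one_left zero_le (hψ01 x)
      · simp [hh, hψK x hx]
    have e2 : (∫⁻ x, ‖h x‖ₑ ^ p) ^ (1 / p) ≤ S ^ (1 / p) * ∫⁻ x, ‖fderiv ℝ h x‖ₑ := by
      calc (∫⁻ x, ‖h x‖ₑ ^ p) ^ (1 / p) ≤ (S * (∫⁻ x, ‖fderiv ℝ h x‖ₑ) ^ p) ^ (1 / p) := by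
            gcongr
            exact hSob h hh1 hhc
        _ = _ := by
            rw [ENNReal.mul_rpow_of_nonneg _ _ (by positivity), ← ENNReal.rpow_mul,
              mul_one_div_cancel hp.ne', ENNReal.rpow_one]
    have e3 : ∫⁻ x, ‖fderiv ℝ h x‖ₑ ≤
        M * ∫⁻ x in Metric.closedBall z 1, (‖fderiv ℝ f x‖ₑ + ‖f x‖ₑ) := by
      rw [← lintegral_const_mul' _ _ hMt, ← lintegral_indicator measurableSet_closedBall]
      refine lintegral_mono fun x => ?_
      simp only [hh]
      rw [fderiv_fun_mul (hψ1.differentiable (by simp) x) (hf.differentiable (by simp) x)]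
      by_cases hx : x ∈ Metric.closedBall z 1
      · rw [indicator_of_mem hx]
        refine (enorm_clm_add_le _ _).trans ?_
        rw [enorm_clm_smul, enorm_clm_smul, mul_add]
        refine add_le_add ?_ ?_
        · exact mul_le_mul' ((hψ01 x).trans (by simp [hM])) le_rfl
        · rw [mul_comm]
          exact mul_le_mul' ((hdψ x).trans (by simp [hM])) le_rfl
      · rw [hψK x hx, hdψK x hx, indicator_of_notMem hx, ← ofReal_norm]
        simp
    calc ∫⁻ x in Metric.closedBall z (1 / 2), ‖f x‖ₑ ^ (1 + 1 / (N : ℝ))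
        ≤ ∫⁻ x, ‖h x‖ₑ ^ (1 + 1 / (N : ℝ)) := by
          rw [← lintegral_indicator measurableSet_closedBall]
          refine lintegral_mono fun x => ?_
          by_cases hx : x ∈ Metric.closedBall z (1 / 2)
          · have : ψ x = 1 := χ.one_of_mem_closedBall (by
              rw [Metric.mem_closedBall, dist_eq_norm] at hx ⊢
              rwa [sub_zero])
            rw [indicator_of_mem hx]
            simp [hh, this]
          · rw [indicator_of_notMem hx]
            exact zero_le
      _ = ∫⁻ x, ‖h x‖ₑ ^ (1 / (N : ℝ)) * (‖h x‖ₑ ^ p) ^ (1 / p) := by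
          refine lintegral_congr fun x => ?_
          rw [← ENNReal.rpow_mul, mul_one_div_cancel hp.ne', add_comm,
            ENNReal.rpow_add_of_nonneg _ _ (by positivity) zero_le_one]
      _ ≤ (∫⁻ x, ‖h x‖ₑ) ^ (1 / (N : ℝ)) * (∫⁻ x, ‖h x‖ₑ ^ p) ^ (1 / p) :=
          ENNReal.lintegral_mul_norm_pow_le hh1.continuous.measurable.enorm.aemeasurable
            (hh1.continuous.measurable.enorm.pow_const p).aemeasurable (by positivity)
            (by positivity) (by simpa using hconj.inv_add_inv_eq_one)
      _ ≤ η ^ (1 / (N : ℝ)) * (S ^ (1 / p) * (M *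
            ∫⁻ x in Metric.closedBall z 1, (‖fderiv ℝ f x‖ₑ + ‖f x‖ₑ))) := by
          refine mul_le_mul' (ENNReal.rpow_le_rpow e1 (by positivity)) (e2.trans ?_)
          gcongr
      _ = _ := by ring
  have hfm : Measurable fun x => ‖f x‖ₑ := hf.continuous.measurable.enorm
  have hdfm : Measurable fun x => ‖fderiv ℝ f x‖ₑ :=
    (hf.continuous_fderiv (by simp)).measurable.enorm
  have hint := lintegral_mono (μ := (volume : Measure (Euc N))) hloc
  rw [lintegral_setLIntegral_closedBall (hfm.pow_const _)] at hint
  have hmc : ∫⁻ z, (η ^ (1 / (N : ℝ)) * S ^ (1 / p) * M) *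
        ∫⁻ x in Metric.closedBall z 1, (‖fderiv ℝ f x‖ₑ + ‖f x‖ₑ)
      ≤ (η ^ (1 / (N : ℝ)) * S ^ (1 / p) * M) *
        (b * ((∫⁻ x, ‖fderiv ℝ f x‖ₑ) + ∫⁻ x, ‖f x‖ₑ)) := by
    have hsum : Measurable fun x => ‖fderiv ℝ f x‖ₑ + ‖f x‖ₑ := hdfm.add hfm
    rw [lintegral_const_mul', lintegral_setLIntegral_closedBall hsum, lintegral_add_left hdfm]
    exact ENNReal.mul_ne_top (ENNReal.mul_ne_top
        (ENNReal.rpow_ne_top_of_nonneg (by positivity) hηt)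
        (ENNReal.rpow_ne_top_of_nonneg (by positivity) hS)) hMt
  replace hint := hint.trans hmc
  calc ∫⁻ x, ‖f x‖ₑ ^ (1 + 1 / (N : ℝ)) = a⁻¹ * (a * ∫⁻ x, ‖f x‖ₑ ^ (1 + 1 / (N : ℝ))) := by
        rw [← mul_assoc, ENNReal.inv_mul_cancel ha0 hat, one_mul]
    _ ≤ a⁻¹ * ((η ^ (1 / (N : ℝ)) * S ^ (1 / p) * M) *
        (b * ((∫⁻ x, ‖fderiv ℝ f x‖ₑ) + ∫⁻ x, ‖f x‖ₑ))) := by gcongr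
    _ = _ := by ring

/-- The Lions-type inequality for truncations of `BV̇` functions. -/
lemma lintegral_trunc_rpow_le {N : ℕ} {A : ℝ≥0∞} (hA : A ≠ ∞)
    (hLi : ∀ (f : Euc N → ℝ) (η : ℝ≥0∞), η ≠ ∞ → ContDiff ℝ 1 f → HasCompactSupport f →
      (∀ z, ∫⁻ x in Metric.closedBall z 1, ‖f x‖ₑ ≤ η) →
      ∫⁻ x, ‖f x‖ₑ ^ (1 + 1 / (N : ℝ)) ≤
        A * (η ^ (1 / (N : ℝ)) * ((∫⁻ x, ‖fderiv ℝ f x‖ₑ) + ∫⁻ x, ‖f x‖ₑ)))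
    {u : Euc N → ℝ} (hm : Measurable u)
    (hv : VanishAtInfinity N u) (hul : LocallyIntegrable u) {C : ℝ} (hC : 0 ≤ C)
    (hu : TV N u univ ≤ ENNReal.ofReal C) (n : ℕ) {η : ℝ≥0∞} (hη : η ≠ ∞)
    (hball : ∀ z, ∫⁻ x in Metric.closedBall z 1, ‖u x‖ₑ ≤ η)
    (hI : ∫⁻ x, ‖trunc n (u x)‖ₑ ≠ ∞) :
    ∫⁻ x, ‖trunc n (u x)‖ₑ ^ (1 + 1 / (N : ℝ)) ≤
      A * (η ^ (1 / (N : ℝ)) * (ENNReal.ofReal C + ∫⁻ x, ‖trunc n (u x)‖ₑ)) := by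
  obtain ⟨f, e, hf1, hf2, he, hf3, hf4, hae⟩ := exists_compactlySupported_seq hm hv hul hC hu n
  have hwm : Measurable fun x => trunc n (u x) := (contDiff_trunc n).continuous.measurable.comp hm
  set I := ∫⁻ x, ‖trunc n (u x)‖ₑ
  obtain ⟨k₀, hk₀⟩ := eventually_atTop.1 (he.eventually_lt_const (ENNReal.zero_lt_top))
  have hfw : ∀ k x, ‖f k x‖ₑ ≤ ‖f k x - trunc n (u x)‖ₑ + ‖trunc n (u x)‖ₑ := fun k x => by
    simpa using enorm_add_le (f k x - trunc n (u x)) (trunc n (u x))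
  have hu' : ∀ x, ‖trunc n (u x)‖ₑ ≤ ‖u x‖ₑ := fun x => by
    rw [← ofReal_norm, ← ofReal_norm]
    exact ENNReal.ofReal_le_ofReal (abs_trunc_le_abs n _)
  refine lintegral_rpow_le_of_tendsto_ae (f := fun k => f (k + k₀))
    (fun k => (hf1 _).continuous.measurable)
    (hae.mono fun x hx => hx.comp (tendsto_add_atTop_nat k₀)) _
    (b := fun k => A * ((η + e (k + k₀)) ^ (1 / (N : ℝ)) *
      ((ENNReal.ofReal C + e (k + k₀)) + (e (k + k₀) + I)))) (fun k => ?_) ?_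
  · refine (hLi _ (η + e (k + k₀)) ?_ (hf1 _) (hf2 _) fun z => ?_).trans ?_
    · exact ENNReal.add_ne_top.2 ⟨hη, (hk₀ _ (Nat.le_add_left _ _)).ne⟩
    · calc ∫⁻ x in Metric.closedBall z 1, ‖f (k + k₀) x‖ₑ
          ≤ ∫⁻ x in Metric.closedBall z 1,
              (‖u x‖ₑ + ‖f (k + k₀) x - trunc n (u x)‖ₑ) := by
            refine lintegral_mono fun x => (hfw _ x).trans ?_
            rw [add_comm]
            gcongr
            exact hu' x
        _ = (∫⁻ x in Metric.closedBall z 1, ‖u x‖ₑ) +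
            ∫⁻ x in Metric.closedBall z 1, ‖f (k + k₀) x - trunc n (u x)‖ₑ :=
            lintegral_add_left hm.enorm _
        _ ≤ η + e (k + k₀) :=
            add_le_add (hball z) ((setLIntegral_le_lintegral _ _).trans (hf3 _))
    · gcongr
      · exact hf4 _
      · refine (lintegral_mono (hfw _)).trans ?_
        rw [lintegral_add_right _ hwm.enorm]
        gcongr
        exact hf3 _
  · have he' := he.comp (tendsto_add_atTop_nat k₀)
    have h1 : Tendsto (fun k => (η + e (k + k₀)) ^ (1 / (N : ℝ))) atTop
        (𝓝 (η ^ (1 / (N : ℝ)))) := by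
      have := (tendsto_const_nhds (x := η)).add he'
      rw [add_zero] at this
      exact ((ENNReal.continuous_rpow_const (y := 1 / (N : ℝ))).tendsto _).comp this
    have h2 : Tendsto (fun k => (ENNReal.ofReal C + e (k + k₀)) + (e (k + k₀) + I)) atTop
        (𝓝 (ENNReal.ofReal C + I)) := by
      have := ((tendsto_const_nhds (x := ENNReal.ofReal C)).add he').add
        (he'.add (tendsto_const_nhds (x := I)))
      simpa using this
    refine ENNReal.Tendsto.const_mul (ENNReal.Tendsto.mul h1 (Or.inr ?_) h2 (Or.inr ?_))
      (Or.inr hA)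
    · exact ENNReal.add_ne_top.2 ⟨ENNReal.ofReal_ne_top, hI⟩
    · exact ENNReal.rpow_ne_top_of_nonneg (by positivity) hη

/-- A function in `BV̇` which is small in `L¹` of all unit balls is rarely large. -/
lemma exists_measure_superlevel_le {N : ℕ} (hN : 2 ≤ N) {C : ℝ} (hC : 0 ≤ C) :
    ∃ A : ℝ≥0∞, A ≠ ∞ ∧ ∀ (u : Euc N → ℝ) (η : ℝ≥0∞), Measurable u → VanishAtInfinity N u →
      LocallyIntegrable u → TV N u univ ≤ ENNReal.ofReal C → η ≠ ∞ →
      (∀ z, ∫⁻ x in Metric.closedBall z 1, ‖u x‖ₑ ≤ η) →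
      volume {x | 1 < |u x|} ≤ A * η ^ (1 / (N : ℝ)) := by
  obtain ⟨S, hS, hSob⟩ := exists_sobolev_const hN
  obtain ⟨A, hA, hLi⟩ := exists_lions_const hN
  have hconj := holderConjugate_dim hN
  have hp1 := hconj.symm.lt
  have hp := hconj.symm.pos
  set p := (N : ℝ) / ((N : ℝ) - 1) with hp_def
  set J : ℝ≥0∞ := 3 ^ p * (S * (ENNReal.ofReal C) ^ p) with hJ
  have hJt : J ≠ ∞ := ENNReal.mul_ne_top (ENNReal.rpow_ne_top_of_nonneg hp.le (by simp))
    (ENNReal.mul_ne_top hS (ENNReal.rpow_ne_top_of_nonneg hp.le (by simp)))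
  set r : ℝ := 1 + 1 / (N : ℝ) with hr
  have hr0 : 0 ≤ r := by positivity
  set c : ℝ≥0∞ := (ENNReal.ofReal (1 / 3)) ^ r with hc
  have hc0 : c ≠ 0 := (ENNReal.rpow_pos (by simp) (by simp)).ne'
  have hct : c ≠ ∞ := ENNReal.rpow_ne_top_of_nonneg hr0 (by simp)
  refine ⟨c⁻¹ * (A * (ENNReal.ofReal C + J)), ?_, fun u η hm hv hul hu hη hball => ?_⟩
  · exact ENNReal.mul_ne_top (ENNReal.inv_ne_top.2 hc0)
      (ENNReal.mul_ne_top hA (ENNReal.add_ne_top.2 ⟨by simp, hJt⟩))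
  have hIJ : ∫⁻ x, ‖trunc 3 (u x)‖ₑ ≤ J := by
    calc ∫⁻ x, ‖trunc 3 (u x)‖ₑ ≤ ∫⁻ x, 3 ^ p * ‖u x‖ₑ ^ p := by
          refine lintegral_mono fun x => ?_
          rw [← ENNReal.mul_rpow_of_nonneg _ _ hp.le]
          by_cases hx : 3 * |u x| ≤ 1
          · rw [trunc_eq_zero (by exact_mod_cast hx)]
            simp
          · push Not at hx
            have h3 : (3 : ℝ≥0∞) * ‖u x‖ₑ = ENNReal.ofReal (3 * |u x|) := by
              rw [ENNReal.ofReal_mul (by norm_num), ← ofReal_norm, Real.norm_eq_abs]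
              simp
            calc ‖trunc 3 (u x)‖ₑ ≤ 3 * ‖u x‖ₑ := by
                  rw [h3, ← ofReal_norm]
                  refine ENNReal.ofReal_le_ofReal ((abs_trunc_le_abs 3 _).trans ?_)
                  linarith [abs_nonneg (u x)]
              _ = (3 * ‖u x‖ₑ) ^ (1 : ℝ) := (ENNReal.rpow_one _).symm
              _ ≤ (3 * ‖u x‖ₑ) ^ p := by
                  refine ENNReal.rpow_le_rpow_of_exponent_le ?_ hp1.le
                  rw [h3]
                  exact ENNReal.one_le_ofReal.2 hx.le
      _ = 3 ^ p * ∫⁻ x, ‖u x‖ₑ ^ p :=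
          lintegral_const_mul _ (hm.enorm.pow_const p)
      _ ≤ J := by
          rw [hJ]
          gcongr
          exact lintegral_rpow_le_of_TV_le hN hS hSob hm hv hul hC hu
  have hL := lintegral_trunc_rpow_le hA hLi hm hv hul hC hu 3 hη hball (ne_top_of_le_ne_top hJt hIJ)
  have hwm : Measurable fun x => ‖trunc 3 (u x)‖ₑ ^ r :=
    ((contDiff_trunc 3).continuous.measurable.comp hm).enorm.pow_const r
  have hmark : c * volume {x | 1 < |u x|} ≤ ∫⁻ x, ‖trunc 3 (u x)‖ₑ ^ r := by
    refine le_trans ?_ (mul_meas_ge_le_lintegral hwm c)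
    refine mul_le_mul' le_rfl (measure_mono fun x hx => ENNReal.rpow_le_rpow ?_ hr0)
    rw [← ofReal_norm]
    exact ENNReal.ofReal_le_ofReal (third_le_abs_trunc hx)
  calc volume {x | 1 < |u x|} = c⁻¹ * (c * volume {x | 1 < |u x|}) := by
        rw [← mul_assoc, ENNReal.inv_mul_cancel hc0 hct, one_mul]
    _ ≤ c⁻¹ * (A * (η ^ (1 / (N : ℝ)) * (ENNReal.ofReal C + J))) := by
        refine mul_le_mul' le_rfl ((hmark.trans hL).trans ?_)
        gcongr
    _ = _ := by ring

lemma exists_closedBall_lintegral_eq_top {N : ℕ} {U : Euc N → ℝ} (hU : Measurable U)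
    (hn : ¬ LocallyIntegrable U) : ∃ x₀, ∫⁻ x in Metric.closedBall x₀ 1, ‖U x‖ₑ = ∞ := by
  contrapose! hn
  refine fun x => ⟨Metric.closedBall x 1, Metric.closedBall_mem_nhds x one_pos, ?_⟩
  exact ⟨hU.aestronglyMeasurable, (hn x).lt_top⟩

lemma exists_translate_lintegral_gt {N : ℕ} {U : Euc N → ℝ} (hU : Measurable U)
    (hn : ¬ LocallyIntegrable U) {K : Set (Euc N)} (hK : IsCompact K)
    (hK1 : K ⊆ Metric.closedBall 0 1) (hK0 : volume K ≠ 0) :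
    ∃ y, 2 < ∫⁻ x in K, ‖U (x - y)‖ₑ := by
  obtain ⟨x₀, hx₀⟩ := exists_closedBall_lintegral_eq_top hU hn
  by_contra! hle
  have h1 : ∫⁻ y in Metric.closedBall (-x₀) 2, ∫⁻ x in K, ‖U (x - y)‖ₑ ≤
      2 * volume (Metric.closedBall (-x₀) 2) := by
    refine (lintegral_mono hle).trans ?_
    simp
  have h2 : ∫⁻ x in K, ∫⁻ y in Metric.closedBall (-x₀) 2, ‖U (x - y)‖ₑ = ∞ := by
    refine eq_top_iff.2 ?_
    calc ∞ = ∫⁻ x in K, ∞ := by simp [hK0]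
      _ ≤ _ := by
        refine setLIntegral_mono' hK.measurableSet fun x hx => ?_
        rw [← hx₀, ← lintegral_indicator measurableSet_closedBall,
          ← lintegral_indicator measurableSet_closedBall,
          ← lintegral_sub_left_eq_self (fun z => (Metric.closedBall x₀ 1).indicator
            (fun z => ‖U z‖ₑ) z) x]
        refine lintegral_mono fun y => ?_
        by_cases hy : x - y ∈ Metric.closedBall x₀ 1
        · have : y ∈ Metric.closedBall (-x₀) 2 := by
            have hx1 := hK1 hx
            rw [Metric.mem_closedBall, dist_eq_norm] at hy hx1 ⊢
            calc ‖y - -x₀‖ = ‖(x - 0) - (x - y - x₀)‖ := by congr 1; abel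
              _ ≤ ‖x - 0‖ + ‖x - y - x₀‖ := norm_sub_le _ _
              _ ≤ 2 := by linarith
          rw [indicator_of_mem hy, indicator_of_mem this]
        · rw [indicator_of_notMem hy]
          exact zero_le
  rw [lintegral_lintegral_swap, h2] at h1
  · exact absurd h1 (not_le.2 (ENNReal.mul_lt_top (by simp) measure_closedBall_lt_top))
  · exact ((hU.comp (measurable_snd.sub measurable_fst)).enorm).aemeasurable

lemma exists_translate_bounded {N : ℕ} {U : Euc N → ℝ} (hU : Measurable U)
    (hn : ¬ LocallyIntegrable U) {K : Set (Euc N)} (hK : IsCompact K)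
    (hK1 : K ⊆ Metric.closedBall 0 1) (hK0 : volume K ≠ 0) {ε : ℝ≥0∞} (hε : ε ≠ 0) :
    ∃ (y : Euc N) (K' : Set (Euc N)) (M : ℕ), IsCompact K' ∧ K' ⊆ K ∧ volume (K \ K') ≤ ε ∧
      (∀ x ∈ K', ‖U (x - y)‖ₑ ≤ M) ∧ 1 < ∫⁻ x in K', ‖U (x - y)‖ₑ := by
  obtain ⟨y, hy⟩ := exists_translate_lintegral_gt hU hn hK hK1 hK0
  set F : Euc N → ℝ≥0∞ := fun x => ‖U (x - y)‖ₑ with hF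
  have hFm : Measurable F := (hU.comp (measurable_id.sub_const y)).enorm
  set G : ℕ → Set (Euc N) := fun n => K ∩ {x | F x ≤ n} with hG
  have hGm : ∀ n, MeasurableSet (G n) := fun n =>
    hK.measurableSet.inter (measurableSet_le hFm measurable_const)
  have hGmono : Monotone G := fun a b hab x hx =>
    ⟨hx.1, (show F x ≤ a from hx.2).trans (Nat.cast_le.2 hab)⟩
  have hGU : ⋃ n, G n = K := by
    refine Subset.antisymm (iUnion_subset fun n => inter_subset_left) fun x hx => ?_
    obtain ⟨n, hn⟩ := ENNReal.exists_nat_gt (r := F x) (by simp [hF])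
    exact mem_iUnion.2 ⟨n, hx, hn.le⟩
  have hKt : volume K ≠ ∞ := hK.measure_lt_top.ne
  have ht1 : Tendsto (fun n => ∫⁻ x in G n, F x) atTop (𝓝 (∫⁻ x in K, F x)) := by
    have := tendsto_measure_iUnion_atTop (μ := volume.withDensity F) hGmono
    rw [hGU, withDensity_apply _ hK.measurableSet] at this
    refine this.congr fun n => ?_
    rw [Function.comp_apply, withDensity_apply _ (hGm n)]
  have ht2 : Tendsto (fun n => volume (K \ G n)) atTop (𝓝 0) := by
    have := tendsto_measure_iInter_atTop (μ := volume) (s := fun n => K \ G n)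
      (fun n => (hK.measurableSet.diff (hGm n)).nullMeasurableSet)
      (fun a b hab => sdiff_subset_sdiff_right (hGmono hab))
      ⟨0, ne_top_of_le_ne_top hKt (measure_mono sdiff_subset)⟩
    rwa [← sdiff_iUnion, hGU, sdiff_self, measure_empty] at this
  have hε2 : 0 < ε / 2 := ENNReal.half_pos hε
  obtain ⟨n, hn1, hn2⟩ := ((ht1.eventually_const_lt hy).and (ht2.eventually_lt_const hε2)).exists
  have hGt : volume (G n) ≠ ∞ := ne_top_of_le_ne_top hKt (measure_mono inter_subset_left)
  have hδ : min (ε / 2) (n : ℝ≥0∞)⁻¹ ≠ 0 :=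
    (lt_min hε2 (ENNReal.inv_pos.2 (ENNReal.natCast_ne_top n))).ne'
  obtain ⟨K', hK'G, hK', hK'lt⟩ := (hGm n).exists_isCompact_sdiff_lt hGt hδ
  refine ⟨y, K', n, hK', hK'G.trans inter_subset_left, ?_, fun x hx => (hK'G hx).2, ?_⟩
  · have hsub : K \ K' ⊆ (K \ G n) ∪ (G n \ K') := fun x hx => by
      by_cases h : x ∈ G n
      · exact Or.inr ⟨h, hx.2⟩
      · exact Or.inl ⟨hx.1, h⟩
    calc volume (K \ K') ≤ volume (K \ G n) + volume (G n \ K') :=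
          (measure_mono hsub).trans (measure_union_le _ _)
      _ ≤ ε / 2 + ε / 2 := add_le_add hn2.le (hK'lt.le.trans (min_le_left _ _))
      _ = ε := ENNReal.add_halves ε
  · have h3 : ∫⁻ x in G n \ K', F x ≤ 1 := by
      calc ∫⁻ x in G n \ K', F x ≤ ∫⁻ x in G n \ K', n :=
            setLIntegral_mono' ((hGm n).diff hK'.measurableSet) fun x hx => hx.1.2
        _ = n * volume (G n \ K') := by simp
        _ ≤ n * (n : ℝ≥0∞)⁻¹ := by
            gcongr
            exact hK'lt.le.trans (min_le_right _ _)
        _ ≤ 1 := ENNReal.mul_inv_le_one _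
    by_contra! hcon
    have h4 : ∫⁻ x in G n, F x ≤ 2 := by
      rw [← lintegral_inter_add_sdiff F (G n) hK'.measurableSet, inter_eq_self_of_subset_right hK'G]
      calc _ ≤ (1 : ℝ≥0∞) + 1 := add_le_add hcon h3
        _ = 2 := one_add_one_eq_two
    exact absurd hn1 (not_lt.2 h4)

/-- Given countably many functions which are not locally integrable, some translates of them
are uniformly nontrivial, yet integrable, on a common compact set. -/
lemma exists_compact_translates {N : ℕ} {U : ℕ → Euc N → ℝ} (hU : ∀ m, Measurable (U m))
    (hn : ∀ m, ¬ LocallyIntegrable (U m)) :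
    ∃ (K : Set (Euc N)) (y : ℕ → Euc N), IsCompact K ∧ ∀ m,
      ∫⁻ x in K, ‖U m (x - y m)‖ₑ ≠ ∞ ∧ 2⁻¹ ≤ ∫⁻ x in K, ‖U m (x - y m)‖ₑ := by
  let σ := {s : Set (Euc N) × ℝ≥0∞ // IsCompact s.1 ∧ s.1 ⊆ Metric.closedBall 0 1 ∧
    volume s.1 ≠ 0 ∧ s.2 ≠ 0}
  have hstep : ∀ (m : ℕ) (s : σ), ∃ (s' : σ) (y : Euc N) (M : ℕ), s'.1.1 ⊆ s.1.1 ∧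
      volume (s.1.1 \ s'.1.1) ≤ s.1.2 ∧ s'.1.2 ≤ s.1.2 * 2⁻¹ ∧ M * (2 * s'.1.2) ≤ 2⁻¹ ∧
      (∀ x ∈ s'.1.1, ‖U m (x - y)‖ₑ ≤ M) ∧ 1 < ∫⁻ x in s'.1.1, ‖U m (x - y)‖ₑ := by
    rintro m ⟨⟨K, ε⟩, hK, hK1, hK0, hε⟩
    obtain ⟨y, K', M, hK', hsub, hvol, hM, hgt⟩ :=
      exists_translate_bounded (hU m) (hn m) hK hK1 hK0 hε
    have hK'0 : volume K' ≠ 0 := fun h0 => by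
      rw [setLIntegral_measure_zero _ _ h0] at hgt
      exact absurd hgt (by simp)
    have hε' : min (ε * 2⁻¹) ((M : ℝ≥0∞)⁻¹ * 4⁻¹) ≠ 0 :=
      (lt_min (ENNReal.mul_pos hε (by simp)) (ENNReal.mul_pos (by simp) (by simp))).ne'
    refine ⟨⟨⟨K', min (ε * 2⁻¹) ((M : ℝ≥0∞)⁻¹ * 4⁻¹)⟩, hK', hsub.trans hK1, hK'0, hε'⟩, y, M,
      hsub, hvol, min_le_left _ _, ?_, hM, hgt⟩
    calc (M : ℝ≥0∞) * (2 * min (ε * 2⁻¹) ((M : ℝ≥0∞)⁻¹ * 4⁻¹))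
        ≤ M * (2 * ((M : ℝ≥0∞)⁻¹ * 4⁻¹)) := by gcongr; exact min_le_right _ _
      _ = (M * (M : ℝ≥0∞)⁻¹) * (2 * 4⁻¹) := by ring
      _ ≤ 1 * (2 * 4⁻¹) := by gcongr; exact ENNReal.mul_inv_le_one _
      _ = 2⁻¹ := by
        rw [one_mul, show (4 : ℝ≥0∞) = 2 * 2 by norm_num,
          ENNReal.mul_inv (by simp) (by simp), ← mul_assoc,
          ENNReal.mul_inv_cancel (by simp) (by simp), one_mul]
  choose nxt y M h1 h2 h3 h4 h5 h6 using hstep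
  let s₀ : σ := ⟨⟨Metric.closedBall 0 1, 1⟩, isCompact_closedBall _ _, le_rfl,
    (Metric.measure_closedBall_pos volume _ one_pos).ne', one_ne_zero⟩
  let s : ℕ → σ := fun m => Nat.rec s₀ (fun m t => nxt m t) m
  have hs : ∀ m, s (m + 1) = nxt m (s m) := fun _ => rfl
  let K : ℕ → Set (Euc N) := fun m => (s m).1.1
  have hKanti : Antitone K := antitone_nat_of_succ_le fun m => h1 m (s m)
  have hKc : ∀ m, IsCompact (K m) := fun m => (s m).2.1
  have hε : ∀ m i, (s (m + i)).1.2 ≤ (s m).1.2 * 2⁻¹ ^ i := fun m i => by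
    induction i with
    | zero => simp
    | succ i ih =>
      calc (s (m + i + 1)).1.2 ≤ (s (m + i)).1.2 * 2⁻¹ := h3 _ _
        _ ≤ ((s m).1.2 * 2⁻¹ ^ i) * 2⁻¹ := by gcongr
        _ = _ := by rw [pow_succ, mul_assoc]
  set L := ⋂ m, K m with hL
  have hLc : IsCompact L := (hKc 0).of_isClosed_subset
    (isClosed_iInter fun m => (hKc m).isClosed) (iInter_subset K 0)
  have hdiff : ∀ m, volume (K m \ L) ≤ 2 * (s m).1.2 := fun m => by
    have hsub : K m \ L ⊆ ⋃ i, K (m + i) \ K (m + i + 1) := by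
      intro x hx
      by_contra hcon
      simp only [mem_iUnion, not_exists, Set.mem_sdiff, not_and, not_not] at hcon
      have hall : ∀ i, x ∈ K (m + i) := fun i => by
        induction i with
        | zero => exact hx.1
        | succ i ih => exact hcon i ih
      exact hx.2 (mem_iInter.2 fun k => hKanti (Nat.le_add_left k m) (hall k))
    calc volume (K m \ L) ≤ ∑' i, volume (K (m + i) \ K (m + i + 1)) :=
          (measure_mono hsub).trans (measure_iUnion_le _)
      _ ≤ ∑' i, (s m).1.2 * 2⁻¹ ^ i := ENNReal.tsum_le_tsum fun i => (h2 _ _).trans (hε m i)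
      _ = 2 * (s m).1.2 := by
          rw [ENNReal.tsum_mul_left, ENNReal.tsum_geometric, ENNReal.one_sub_inv_two, inv_inv,
            mul_comm]
  refine ⟨L, fun m => y m (s m), hLc, fun m => ?_⟩
  have hLK : L ⊆ K (m + 1) := iInter_subset K (m + 1)
  set F : Euc N → ℝ≥0∞ := fun x => ‖U m (x - y m (s m))‖ₑ
  have hFM : ∀ x ∈ K (m + 1), F x ≤ M m (s m) := h5 m (s m)
  constructor
  · refine ne_top_of_le_ne_top (b := M m (s m) * volume L)
      (ENNReal.mul_ne_top (by simp) hLc.measure_lt_top.ne) ?_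
    exact (setLIntegral_mono' hLc.measurableSet fun x hx => hFM x (hLK hx)).trans (by simp)
  · have hsplit := lintegral_inter_add_sdiff F (K (m + 1)) hLc.measurableSet (μ := volume)
    rw [inter_eq_self_of_subset_right hLK] at hsplit
    have hd : ∫⁻ x in K (m + 1) \ L, F x ≤ 2⁻¹ := by
      calc ∫⁻ x in K (m + 1) \ L, F x ≤ ∫⁻ x in K (m + 1) \ L, M m (s m) :=
            setLIntegral_mono' ((hKc (m + 1)).measurableSet.diff hLc.measurableSet)
              fun x hx => hFM x hx.1
        _ = M m (s m) * volume (K (m + 1) \ L) := by simp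
        _ ≤ M m (s m) * (2 * (s (m + 1)).1.2) := by gcongr; exact hdiff (m + 1)
        _ ≤ 2⁻¹ := h4 m (s m)
    by_contra! hcon
    have : ∫⁻ x in K (m + 1), F x < 1 := by
      rw [← hsplit, ← ENNReal.inv_two_add_inv_two]
      exact ENNReal.add_lt_add_of_lt_of_le (ne_top_of_le_ne_top (by simp) hd) hcon hd
    exact absurd (h6 m (s m)) (not_lt.2 this.le)

/-- If all translates of `u k` tend to zero in the sense of (possibly junk-valued) integrals over
compact sets, then the `u k` are eventually locally integrable. -/
lemma eventually_locallyIntegrable {N : ℕ} {u : ℕ → Euc N → ℝ} (hm : ∀ k, Measurable (u k))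
    (h : ∀ (y : ℕ → Euc N) (K : Set (Euc N)), IsCompact K →
      Tendsto (fun k => ∫ x in K, |u k (x - y k)|) atTop (𝓝 0)) :
    ∀ᶠ k in atTop, LocallyIntegrable (u k) := by
  by_contra hcon
  obtain ⟨ns, hns, hnot⟩ := extraction_of_frequently_atTop (not_eventually.1 hcon)
  obtain ⟨K, y, hK, hy⟩ := exists_compact_translates (fun m => hm (ns m)) hnot
  have hlim := (h (Function.extend ns y 0) K hK).comp hns.tendsto_atTop
  have hge : ∀ m, (2⁻¹ : ℝ) ≤ ∫ x in K, |u (ns m) (x - Function.extend ns y 0 (ns m))| :=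
      fun m => by
    rw [hns.injective.extend_apply]
    have hmeas : Measurable fun x => u (ns m) (x - y m) := (hm _).comp (measurable_id.sub_const _)
    have := integral_norm_eq_lintegral_enorm (μ := volume.restrict K) hmeas.aestronglyMeasurable
    simp only [Real.norm_eq_abs] at this
    rw [this]
    have h2 := (ENNReal.toReal_le_toReal (by simp) (hy m).1).2 (hy m).2
    simpa using h2
  have := ge_of_tendsto' hlim hge
  norm_num at this

lemma measurable_resc {N : ℕ} (j : ℤ) (y : Euc N) {u : Euc N → ℝ} (hm : Measurable u) :
    Measurable (resc N j y u) :=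
  measurable_const.mul (hm.comp ((measurable_const_smul ((2 : ℝ) ^ j)).comp
    (measurable_id.sub_const y)))

lemma locallyIntegrable_resc {N : ℕ} (j : ℤ) (y : Euc N) {u : Euc N → ℝ}
    (hu : LocallyIntegrable u) : LocallyIntegrable (resc N j y u) := by
  have hc : (2 : ℝ) ^ j ≠ 0 := by positivity
  rw [locallyIntegrable_iff] at hu ⊢
  intro K hK
  refine Integrable.const_mul ?_ _
  have hL : IsCompact ((fun x => (2 : ℝ) ^ j • (x - y)) '' K) := hK.image (by fun_prop)
  have h1 := (integrable_indicator_iff hL.measurableSet).2 (hu _ hL)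
  have h2 := ((integrable_comp_smul_iff volume _ hc).2 h1).comp_sub_right y
  have h3 : IntegrableOn (fun x => u ((2 : ℝ) ^ j • (x - y))) K := by
    refine (h2.integrableOn (s := K)).congr_fun (fun x hx => ?_) hK.measurableSet
    exact indicator_of_mem (mem_image_of_mem _ hx) _
  exact h3

lemma resc_superlevel {N : ℕ} (j : ℤ) (u : Euc N → ℝ) (M : ℝ) :
    volume {x | M < |resc N j 0 u x|} = ENNReal.ofReal (((2 : ℝ) ^ j) ^ N)⁻¹ *
      volume {x | M / 2 ^ (((N : ℤ) - 1) * j) < |u x|} := by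
  have hc : (2 : ℝ) ^ j ≠ 0 := by positivity
  have hd : (0 : ℝ) < 2 ^ (((N : ℤ) - 1) * j) := by positivity
  have := Measure.addHaar_preimage_smul (volume : Measure (Euc N)) hc
    {x | M / 2 ^ (((N : ℤ) - 1) * j) < |u x|}
  rw [finrank_euclideanSpace_fin, abs_of_pos (by positivity)] at this
  rw [← this]
  congr 1
  ext x
  simp only [resc, mem_preimage, mem_ofPred_eq, sub_zero, abs_mul, abs_of_pos hd, div_lt_iff₀ hd]
  rw [mul_comm]

lemma vanishAtInfinity_resc {N : ℕ} (j : ℤ) {u : Euc N → ℝ} (hv : VanishAtInfinity N u) :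
    VanishAtInfinity N (resc N j 0 u) := fun M hM => by
  rw [resc_superlevel]
  exact ENNReal.mul_lt_top (by simp) (hv _ (by positivity))

lemma TV_resc_le {N : ℕ} (j : ℤ) (u : Euc N → ℝ) :
    TV N (resc N j 0 u) univ ≤ TV N u univ := by
  have hc : (0 : ℝ) < 2 ^ j := by positivity
  refine iSup_le fun v => iSup_le fun hv => iSup_le fun hv' => iSup_le fun hv1 =>
    iSup_le fun _ => ?_
  set c : ℝ := 2 ^ j with hcdef
  set V : Euc N → Euc N := fun x => v (c⁻¹ • x) with hV
  have hVs : ContDiff ℝ (⊤ : ℕ∞) V := hv.comp (contDiff_const_smul _)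
  have hVc : HasCompactSupport V :=
    hv'.comp_homeomorph (Homeomorph.smulOfNeZero c⁻¹ (inv_ne_zero hc.ne'))
  have hdiv : ∀ x, divg N V (c • x) = c⁻¹ * divg N v x := fun x => by
    have hfd : fderiv ℝ V (c • x) = c⁻¹ • fderiv ℝ v x := by
      rw [hV, fderiv_comp_smul, inv_smul_smul₀ hc.ne']
    simp [divg, hfd, Finset.mul_sum]
  have hint : ∫ x, resc N j 0 u x * divg N v x = ∫ x, u x * divg N V x := by
    have h1 := Measure.integral_comp_smul (volume : Measure (Euc N))
      (fun x => u x * divg N V x) c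
    rw [finrank_euclideanSpace_fin, abs_of_pos (by positivity), smul_eq_mul] at h1
    have h2 : ∀ x, resc N j 0 u x * divg N v x = c ^ N * (u (c • x) * divg N V (c • x)) :=
        fun x => by
      have h3 : (2 : ℝ) ^ (((N : ℤ) - 1) * j) = c ^ N * c⁻¹ := by
        rw [mul_comm, zpow_mul, ← hcdef, zpow_sub₀ hc.ne', zpow_natCast, zpow_one]
        rfl
      rw [hdiv, resc, sub_zero, h3]
      ring
    simp_rw [h2]
    rw [integral_const_mul, h1, ← mul_assoc, mul_inv_cancel₀ (by positivity), one_mul]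
  rw [hint]
  exact le_iSup_of_le V (le_iSup_of_le hVs (le_iSup_of_le hVc
    (le_iSup_of_le (fun x => hv1 _) (le_iSup_of_le (subset_univ _) le_rfl))))

lemma setLIntegral_closedBall_resc {N : ℕ} (j : ℤ) (z : Euc N) (u : Euc N → ℝ) :
    ∫⁻ x in Metric.closedBall z 1, ‖resc N j 0 u x‖ₑ =
      ∫⁻ x in Metric.closedBall 0 1, ‖resc N j (-z) u x‖ₑ := by
  rw [← lintegral_indicator measurableSet_closedBall,
    ← lintegral_indicator measurableSet_closedBall, ← lintegral_add_right_eq_self _ z]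
  refine lintegral_congr fun x => ?_
  by_cases hx : x ∈ Metric.closedBall (0 : Euc N) 1
  · have : x + z ∈ Metric.closedBall z 1 := by simpa [dist_eq_norm] using hx
    rw [indicator_of_mem hx, indicator_of_mem this]
    simp [resc]
  · have : x + z ∉ Metric.closedBall z 1 := by simpa [dist_eq_norm] using hx
    rw [indicator_of_notMem hx, indicator_of_notMem this]

/-- The largest mass on the unit ball of the images of `u` under the rescaling group. -/
def unitBallMass (N : ℕ) (u : Euc N → ℝ) : ℝ≥0∞ :=
  ⨆ a : ℤ × Euc N, ∫⁻ x in Metric.closedBall 0 1, ‖resc N a.1 a.2 u x‖ₑ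

lemma tendsto_unitBallMass {N : ℕ} {u : ℕ → Euc N → ℝ}
    (hul : ∀ᶠ k in atTop, LocallyIntegrable (u k))
    (h : ∀ (j : ℕ → ℤ) (y : ℕ → Euc N) (K : Set (Euc N)), IsCompact K →
      Tendsto (fun k => ∫ x in K, |resc N (j k) (y k) (u k) x|) atTop (𝓝 0)) :
    Tendsto (fun k => unitBallMass N (u k)) atTop (𝓝 0) := by
  rw [ENNReal.tendsto_nhds_zero]
  intro ε hε
  have hch : ∀ k, ∃ a : ℤ × Euc N, ε < unitBallMass N (u k) →
      ε < ∫⁻ x in Metric.closedBall 0 1, ‖resc N a.1 a.2 (u k) x‖ₑ := fun k => by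
    by_cases hk : ε < unitBallMass N (u k)
    · obtain ⟨a, ha⟩ := lt_iSup_iff.1 hk
      exact ⟨a, fun _ => ha⟩
    · exact ⟨0, fun h => absurd h hk⟩
  choose a ha using hch
  have hK := isCompact_closedBall (0 : Euc N) 1
  have hlim := ENNReal.tendsto_ofReal (h (fun k => (a k).1) (fun k => (a k).2) _ hK)
  rw [ENNReal.ofReal_zero] at hlim
  filter_upwards [hul, hlim.eventually_lt_const hε] with k hk hk'
  by_contra! hcon
  have hi := (locallyIntegrable_resc (a k).1 (a k).2 hk).integrableOn_isCompact hK
  have := ofReal_integral_norm_eq_lintegral_enorm hi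
  simp only [Real.norm_eq_abs] at this
  rw [this] at hk'
  exact lt_asymm hk' (ha k hcon)

/-- The weak-type estimate by the mass of rescalings on the unit ball. -/
lemma rpow_mul_measure_superlevel_le {N : ℕ} (hN : 2 ≤ N) {u : Euc N → ℝ} {τ : ℝ≥0∞}
    (h : ∀ j : ℤ, volume {x | 1 < |resc N j 0 u x|} ≤ τ) {l : ℝ} (hl : 0 < l) :
    ENNReal.ofReal l ^ ((N : ℝ) / ((N : ℝ) - 1)) * volume {x | l < |u x|} ≤ 2 ^ N * τ := by
  have hN1 : (0 : ℝ) < (N : ℝ) - 1 := by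
    have : (2 : ℝ) ≤ N := by exact_mod_cast hN
    linarith
  have hNm : ((N - 1 : ℕ) : ℝ) = (N : ℝ) - 1 := by
    rw [Nat.cast_sub (by omega), Nat.cast_one]
  obtain ⟨n, hn1, hn2⟩ := exists_mem_Ico_zpow (x := l ^ (1 / ((N : ℝ) - 1))) (y := 2)
    (by positivity) one_lt_two
  set c : ℝ := 2 ^ n with hc
  have hc0 : 0 < c := by positivity
  have hroot : (l ^ (1 / ((N : ℝ) - 1))) ^ (N - 1) = l := by
    rw [← Real.rpow_natCast, hNm, ← Real.rpow_mul hl.le, one_div_mul_cancel hN1.ne',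
      Real.rpow_one]
  have hlow : c ^ (N - 1) ≤ l := by
    rw [← hroot]
    gcongr
  have hup : l ^ ((N : ℝ) / ((N : ℝ) - 1)) ≤ (2 * c) ^ N := by
    have e : l ^ ((N : ℝ) / ((N : ℝ) - 1)) = (l ^ (1 / ((N : ℝ) - 1))) ^ N := by
      rw [← Real.rpow_natCast, ← Real.rpow_mul hl.le]
      congr 1
      ring
    rw [e]
    gcongr
    rw [zpow_add_one₀ two_ne_zero] at hn2
    linarith
  have hj := h (-n)
  rw [resc_superlevel] at hj
  have e1 : ((2 : ℝ) ^ (-n)) ^ N = (c ^ N)⁻¹ := by rw [zpow_neg, inv_pow]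
  have e2 : 1 / (2 : ℝ) ^ (((N : ℤ) - 1) * -n) = c ^ (N - 1) := by
    rw [mul_neg, zpow_neg, one_div, inv_inv, mul_comm, zpow_mul, ← zpow_natCast,
      Nat.cast_sub (by omega), Nat.cast_one]
  rw [e1, e2, inv_inv] at hj
  have hp : 0 ≤ (N : ℝ) / ((N : ℝ) - 1) := by positivity
  calc ENNReal.ofReal l ^ ((N : ℝ) / ((N : ℝ) - 1)) * volume {x | l < |u x|}
      ≤ ENNReal.ofReal ((2 * c) ^ N) * volume {x | c ^ (N - 1) < |u x|} := by
        rw [ENNReal.ofReal_rpow_of_nonneg hl.le hp]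
        exact mul_le_mul' (ENNReal.ofReal_le_ofReal hup)
          (measure_mono fun x hx => lt_of_le_of_lt hlow hx)
    _ = 2 ^ N * (ENNReal.ofReal (c ^ N) * volume {x | c ^ (N - 1) < |u x|}) := by
        rw [mul_pow, ENNReal.ofReal_mul (by positivity), mul_assoc,
          ENNReal.ofReal_pow (by norm_num)]
        simp
    _ ≤ 2 ^ N * τ := by gcongr

lemma rearr_nonneg (N : ℕ) (u : Euc N → ℝ) (t : ℝ) : 0 ≤ rearr N u t :=
  Real.sInf_nonneg fun _ hl => hl.1.le

lemma bddBelow_rearr (N : ℕ) (u : Euc N → ℝ) (t : ℝ) :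
    BddBelow {l : ℝ | 0 < l ∧ volume {x : Euc N | l < |u x|} ≤ ENNReal.ofReal t} :=
  ⟨0, fun _ hl => hl.1.le⟩

lemma ofReal_lt_measure_of_lt_rearr {N : ℕ} {u : Euc N → ℝ} {s t : ℝ} (hs : 0 < s)
    (h : s < rearr N u t) : ENNReal.ofReal t < volume {x | s < |u x|} := by
  contrapose! h
  exact csInf_le (bddBelow_rearr N u t) ⟨hs, h⟩

lemma measure_superlevel_le_of_weak {N : ℕ} {u : Euc N → ℝ} {p τ : ℝ}
    (hW : ∀ l : ℝ, 0 < l → ENNReal.ofReal l ^ p * volume {x | l < |u x|} ≤ ENNReal.ofReal τ)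
    {t s : ℝ} (hs : 0 < s) (hst : τ ≤ s ^ p * t) :
    volume {x | s < |u x|} ≤ ENNReal.ofReal t := by
  have hsp : 0 < s ^ p := by positivity
  have h := (hW s hs).trans (ENNReal.ofReal_le_ofReal hst)
  rw [ENNReal.ofReal_rpow_of_pos hs, ENNReal.ofReal_mul hsp.le] at h
  exact (ENNReal.mul_le_mul_iff_right (by simpa using hsp) ENNReal.ofReal_ne_top).1 h

lemma rpow_mul_rearr_le {N : ℕ} {u : Euc N → ℝ} {p τ : ℝ} (hp : 0 < p) (hτ : 0 ≤ τ)
    (hW : ∀ l : ℝ, 0 < l → ENNReal.ofReal l ^ p * volume {x | l < |u x|} ≤ ENNReal.ofReal τ)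
    {t : ℝ} (ht : 0 < t) : t ^ (1 / p) * rearr N u t ≤ τ ^ (1 / p) := by
  have htp : 0 < t ^ (1 / p) := by positivity
  rw [← le_div_iff₀' htp]
  refine le_of_forall_gt_imp_ge_of_dense fun s hs => ?_
  have hs0 : 0 < s := lt_of_le_of_lt (by positivity) hs
  refine csInf_le (bddBelow_rearr N u t) ⟨hs0, measure_superlevel_le_of_weak hW hs0 ?_⟩
  rw [← Real.div_rpow hτ ht.le] at hs
  have := Real.rpow_le_rpow (by positivity) hs.le hp.le
  rw [← Real.rpow_mul (by positivity), one_div_mul_cancel hp.ne', Real.rpow_one,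
    div_le_iff₀ ht] at this
  exact this

lemma antitoneOn_rearr {N : ℕ} {u : Euc N → ℝ} {p τ : ℝ} (hp : 0 < p) (hτ : 0 ≤ τ)
    (hW : ∀ l : ℝ, 0 < l → ENNReal.ofReal l ^ p * volume {x | l < |u x|} ≤ ENNReal.ofReal τ) :
    AntitoneOn (rearr N u) (Ioi 0) := by
  intro a ha b _ hab
  have ha : 0 < a := ha
  refine csInf_le_csInf (bddBelow_rearr N u b) ⟨(τ / a) ^ (1 / p) + 1, by positivity,
    measure_superlevel_le_of_weak hW (by positivity) ?_⟩ fun l hl =>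
      ⟨hl.1, hl.2.trans (ENNReal.ofReal_le_ofReal hab)⟩
  rw [← div_le_iff₀ ha]
  calc τ / a = ((τ / a) ^ (1 / p)) ^ p := by
        rw [← Real.rpow_mul (by positivity), one_div_mul_cancel hp.ne', Real.rpow_one]
    _ ≤ ((τ / a) ^ (1 / p) + 1) ^ p :=
        Real.rpow_le_rpow (by positivity) (by linarith) hp.le

lemma lintegral_rearr_rpow_le {N : ℕ} {u : Euc N → ℝ} (hm : Measurable u) {p τ : ℝ} (hp : 0 < p)
    (hτ : 0 ≤ τ)
    (hW : ∀ l : ℝ, 0 < l → ENNReal.ofReal l ^ p * volume {x | l < |u x|} ≤ ENNReal.ofReal τ) :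
    ∫⁻ t in Ioi (0 : ℝ), ENNReal.ofReal (rearr N u t ^ p) ≤ ∫⁻ x, ‖u x‖ₑ ^ p := by
  have h1 : ∀ x, ‖u x‖ₑ ^ p = ENNReal.ofReal (|u x| ^ p) := fun x => by
    rw [← ofReal_norm, Real.norm_eq_abs, ENNReal.ofReal_rpow_of_nonneg (abs_nonneg _) hp.le]
  simp_rw [h1]
  rw [lintegral_rpow_eq_lintegral_meas_lt_mul _
      (Eventually.of_forall fun t => rearr_nonneg N u t)
      (aemeasurable_restrict_of_antitoneOn measurableSet_Ioi (antitoneOn_rearr hp hτ hW)) hp,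
    lintegral_rpow_eq_lintegral_meas_lt_mul _
      (Eventually.of_forall fun x => abs_nonneg (u x)) hm.abs.aemeasurable hp]
  gcongr ENNReal.ofReal p * ?_
  refine setLIntegral_mono' measurableSet_Ioi fun s hs => ?_
  gcongr ?_ * _
  have hs : 0 < s := hs
  rw [Measure.restrict_apply' measurableSet_Ioi]
  by_cases hV : volume {x | s < |u x|} = ∞
  · rw [hV]
    exact le_top
  · calc volume ({t | s < rearr N u t} ∩ Ioi 0)
        ≤ volume (Ioc 0 (volume {x | s < |u x|}).toReal) := by
          refine measure_mono fun t ht => ⟨ht.2, ?_⟩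
          have := ofReal_lt_measure_of_lt_rearr hs ht.1
          exact (ENNReal.ofReal_le_iff_le_toReal hV).1 this.le
      _ = volume {x | s < |u x|} := by
          rw [Real.volume_Ioc, sub_zero, ENNReal.ofReal_toReal hV]

/-- The weak-type quasinorm together with the `L^p` norm controls the `L^{p,q}` quasinorms,
`q > p`. -/
lemma lorentz_le {N : ℕ} {u : Euc N → ℝ} (hm : Measurable u) {p τ : ℝ} (hp : 0 < p)
    (hτ : 0 ≤ τ)
    (hW : ∀ l : ℝ, 0 < l → ENNReal.ofReal l ^ p * volume {x | l < |u x|} ≤ ENNReal.ofReal τ)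
    {q : ℝ≥0∞} (hq : ENNReal.ofReal p < q) {B : ℝ≥0∞} (hB : ∫⁻ x, ‖u x‖ₑ ^ p ≤ B) :
    lorentz N p q u ≤ if q = ∞ then ENNReal.ofReal (τ ^ (1 / p)) else
      (ENNReal.ofReal ((τ ^ (1 / p)) ^ (q.toReal - p)) * B) ^ (1 / q.toReal) := by
  unfold lorentz
  split_ifs with hqt
  · exact iSup₂_le fun t ht => ENNReal.ofReal_le_ofReal (rpow_mul_rearr_le hp hτ hW ht)
  · have hpq : p < q.toReal := (ENNReal.ofReal_lt_iff_lt_toReal hp.le hqt).1 hq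
    refine ENNReal.rpow_le_rpow ?_ (by positivity)
    calc ∫⁻ t in Ioi (0 : ℝ), ENNReal.ofReal ((t ^ (1 / p) * rearr N u t) ^ q.toReal / t)
        ≤ ∫⁻ t in Ioi (0 : ℝ), ENNReal.ofReal ((τ ^ (1 / p)) ^ (q.toReal - p)) *
            ENNReal.ofReal (rearr N u t ^ p) := by
          refine setLIntegral_mono' measurableSet_Ioi fun t ht => ?_
          have ht : 0 < t := ht
          have hr := rearr_nonneg N u t
          rw [← ENNReal.ofReal_mul (by positivity)]
          refine ENNReal.ofReal_le_ofReal ?_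
          have hs : (t ^ (1 / p) * rearr N u t) ^ q.toReal / t =
              (t ^ (1 / p) * rearr N u t) ^ (q.toReal - p) * rearr N u t ^ p := by
            have e : (t ^ (1 / p) * rearr N u t) ^ p = t * rearr N u t ^ p := by
              rw [Real.mul_rpow (by positivity) hr, ← Real.rpow_mul ht.le,
                one_div_mul_cancel hp.ne', Real.rpow_one]
            have e2 : (t ^ (1 / p) * rearr N u t) ^ q.toReal =
                (t ^ (1 / p) * rearr N u t) ^ (q.toReal - p) *
                  (t ^ (1 / p) * rearr N u t) ^ p := by
              rw [← Real.rpow_add_of_nonneg (by positivity) (by linarith) hp.le, sub_add_cancel]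
            rw [e2, e]
            field_simp
          rw [hs]
          gcongr
          exact rpow_mul_rearr_le hp hτ hW ht
      _ = ENNReal.ofReal ((τ ^ (1 / p)) ^ (q.toReal - p)) *
            ∫⁻ t in Ioi (0 : ℝ), ENNReal.ofReal (rearr N u t ^ p) :=
          lintegral_const_mul' _ _ ENNReal.ofReal_ne_top
      _ ≤ _ := by
          gcongr
          exact (lintegral_rearr_rpow_le hm hp hτ hW).trans hB

lemma tendsto_lorentz_zero {N : ℕ} {u : ℕ → Euc N → ℝ} (hm : ∀ k, Measurable (u k)) {p : ℝ}
    (hp : 0 < p) {τ : ℕ → ℝ≥0∞} (hτ : Tendsto τ atTop (𝓝 0))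
    (hW : ∀ᶠ k in atTop, ∀ l : ℝ, 0 < l →
      ENNReal.ofReal l ^ p * volume {x | l < |u k x|} ≤ τ k)
    {q : ℝ≥0∞} (hq : ENNReal.ofReal p < q) {B : ℝ≥0∞} (hBt : B ≠ ∞)
    (hB : ∀ᶠ k in atTop, ∫⁻ x, ‖u k x‖ₑ ^ p ≤ B) :
    Tendsto (fun k => lorentz N p q (u k)) atTop (𝓝 0) := by
  have hτr : Tendsto (fun k => (τ k).toReal ^ (1 / p)) atTop (𝓝 0) := by
    have h1 : Tendsto (fun k => (τ k).toReal) atTop (𝓝 0) := by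
      exact (ENNReal.tendsto_toReal zero_ne_top).comp hτ
    simpa [hp.ne'] using h1.rpow_const (p := 1 / p) (Or.inr (by positivity))
  have hle : ∀ᶠ k in atTop, lorentz N p q (u k) ≤
      if q = ∞ then ENNReal.ofReal ((τ k).toReal ^ (1 / p)) else
      (ENNReal.ofReal (((τ k).toReal ^ (1 / p)) ^ (q.toReal - p)) * B) ^ (1 / q.toReal) := by
    filter_upwards [hW, hB, hτ.eventually_lt_const ENNReal.zero_lt_top] with k hWk hBk hτk
    refine lorentz_le (hm k) hp ENNReal.toReal_nonneg ?_ hq hBk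
    rwa [ENNReal.ofReal_toReal hτk.ne]
  refine tendsto_of_tendsto_of_tendsto_of_le_of_le' tendsto_const_nhds ?_
    (Eventually.of_forall fun _ => zero_le) hle
  split_ifs with hqt
  · simpa using ENNReal.tendsto_ofReal hτr
  · have hpq : p < q.toReal := (ENNReal.ofReal_lt_iff_lt_toReal hp.le hqt).1 hq
    have h2 := hτr.rpow_const (p := q.toReal - p) (Or.inr (by linarith))
    rw [Real.zero_rpow (by linarith)] at h2
    have h3 := ENNReal.Tendsto.mul_const (b := B) (ENNReal.tendsto_ofReal h2) (Or.inr hBt)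
    rw [ENNReal.ofReal_zero, zero_mul] at h3
    have h4 := ((ENNReal.continuous_rpow_const (y := 1 / q.toReal)).tendsto _).comp h3
    rwa [ENNReal.zero_rpow_of_pos (by have := hp.trans hpq; positivity)] at h4

/-- cocompactness of `BV̇(ℝ^N) ↪ L^{1*,q}(ℝ^N)` for `1* < q ≤ ∞`,
with respect to the rescaling group `D`. -/
theorem cocompact_BVdot_into_Lorentz_large_q
    (N : ℕ) (hN : 2 ≤ N) (q : ℝ≥0∞) (hq : ENNReal.ofReal ((N : ℝ) / ((N : ℝ) - 1)) < q)
    (u : ℕ → Euc N → ℝ) (hmem : ∀ k, MemBVdot N (u k))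
    (hbdd : ∃ C : ℝ≥0∞, C ≠ ∞ ∧ ∀ k, TV N (u k) univ ≤ C)
    (hvan : ∀ (j : ℕ → ℤ) (y : ℕ → Euc N),
      WeakBVconv N (fun k => resc N (j k) (y k) (u k)) 0) :
    Tendsto (fun k => lorentz N ((N : ℝ) / ((N : ℝ) - 1)) q (u k)) atTop (𝓝 0) := by
  obtain ⟨C, hCt, hC⟩ := hbdd
  have hC' : ∀ k, TV N (u k) univ ≤ ENNReal.ofReal C.toReal := fun k => by
    rw [ENNReal.ofReal_toReal hCt]
    exact hC k
  have hm : ∀ k, Measurable (u k) := fun k => (hmem k).1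
  have hvan' : ∀ (j : ℕ → ℤ) (y : ℕ → Euc N) (K : Set (Euc N)), IsCompact K →
      Tendsto (fun k => ∫ x in K, |resc N (j k) (y k) (u k) x|) atTop (𝓝 0) := fun j y K hK => by
    simpa using (hvan j y).1 K hK
  have hul : ∀ᶠ k in atTop, LocallyIntegrable (u k) :=
    eventually_locallyIntegrable hm fun y K hK => by
      simpa [resc] using hvan' (fun _ => 0) y K hK
  have hη := tendsto_unitBallMass hul hvan'
  have hNpos := (holderConjugate_dim hN).pos
  obtain ⟨A, hA, hAle⟩ := exists_measure_superlevel_le hN (ENNReal.toReal_nonneg (a := C))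
  obtain ⟨S, hS, hSob⟩ := exists_sobolev_const hN
  have hp := (holderConjugate_dim hN).symm.pos
  have hτ : Tendsto (fun k => 2 ^ N * (A * unitBallMass N (u k) ^ (1 / (N : ℝ)))) atTop (𝓝 0) := by
    have h1 := ((ENNReal.continuous_rpow_const (y := 1 / (N : ℝ))).tendsto _).comp hη
    rw [ENNReal.zero_rpow_of_pos (by positivity)] at h1
    have h2 := ENNReal.Tendsto.const_mul (a := 2 ^ N)
      (ENNReal.Tendsto.const_mul h1 (Or.inr hA)) (Or.inr (ENNReal.pow_ne_top (by simp)))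
    simpa using h2
  refine tendsto_lorentz_zero hm hp hτ ?_ hq
    (B := S * (ENNReal.ofReal C.toReal) ^ ((N : ℝ) / ((N : ℝ) - 1))) ?_ ?_
  · filter_upwards [hul, hη.eventually_lt_const ENNReal.zero_lt_top] with k hk hηk l hl
    refine rpow_mul_measure_superlevel_le hN (fun j => ?_) hl
    refine hAle _ _ (measurable_resc j 0 (hm k)) (vanishAtInfinity_resc j (hmem k).2.1)
      (locallyIntegrable_resc j 0 hk) ((TV_resc_le j (u k)).trans (hC' k)) hηk.ne fun z => ?_
    rw [setLIntegral_closedBall_resc]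
    exact le_iSup (fun a : ℤ × Euc N =>
      ∫⁻ x in Metric.closedBall 0 1, ‖resc N a.1 a.2 (u k) x‖ₑ) (j, -z)
  · exact ENNReal.mul_ne_top hS (ENNReal.rpow_ne_top_of_nonneg hp.le (by simp))
  · filter_upwards [hul] with k hk
    exact lintegral_rpow_le_of_TV_le hN hS hSob (hm k) (hmem k).2.1 hk ENNReal.toReal_nonneg
      (hC' k)
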